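/- arXiv:2307.00087 — 3 statements merged into one kernel-verified Lean document; each statement's English description precedes it below -/
import Mathlib

section
/- For every real ω > 0 there exist T > 0 and a nonconstant T-periodic function x : ℝ → ℝ of class C² such that: (i) at every time t with x(t) ≠ 0 the second derivative x'' is differentiable at t and x'''(t) + |x(t)|·x''(t) + 2·(|x(t)|/x(t))·x'(t)² = 0; and (ii) x(t)·x''(t) − x'(t)²/2 + |x(t)|·x(t)·x'(t) = −ω² for all t ∈ ℝ. (This expresses that for q = 1 and k = q + 1 = 2 the generalized Chazy differential equation has, on each negative energy level H = −ω², a periodic orbit; the union of these orbits over ω > 0 is an invariant topological cylinder foliated by periodic orbits.) -/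
open Set Filter Topology Metric

theorem le_of_hasDerivAt_nonneg {f f' : ℝ → ℝ} {a b : ℝ} (hab : a ≤ b)
    (hf : ∀ t ∈ Icc a b, HasDerivAt f (f' t) t) (hf' : ∀ t ∈ Icc a b, 0 ≤ f' t) :
    f a ≤ f b :=
  monotoneOn_of_hasDerivWithinAt_nonneg (convex_Icc a b)
    (fun t ht => (hf t ht).continuousAt.continuousWithinAt)
    (fun t ht => (hf t (interior_subset ht)).hasDerivWithinAt)
    (fun t ht => hf' t (interior_subset ht)) (left_mem_Icc.2 hab) (right_mem_Icc.2 hab) hab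

theorem le_of_hasDerivAt_nonpos {f f' : ℝ → ℝ} {a b : ℝ} (hab : a ≤ b)
    (hf : ∀ t ∈ Icc a b, HasDerivAt f (f' t) t) (hf' : ∀ t ∈ Icc a b, f' t ≤ 0) :
    f b ≤ f a :=
  neg_le_neg_iff.1 (le_of_hasDerivAt_nonneg (f := fun t => -f t) (f' := fun t => -f' t) hab
    (fun t ht => (hf t ht).neg) (fun t ht => neg_nonneg.2 (hf' t ht)))

theorem eventually_sign_of_hasDerivAt_pos {f : ℝ → ℝ} {d t : ℝ} (hf : HasDerivAt f d t)
    (hd : 0 < d) (h0 : f t = 0) : ∀ᶠ s in 𝓝 t, SignType.sign (f s) = SignType.sign (s - t) :=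
  eventually_nhdsWithin_sign_eq_of_deriv_pos (by rwa [hf.deriv]) h0

theorem eventually_neg_right_of_hasDerivAt_neg {f : ℝ → ℝ} {d t : ℝ} (hf : HasDerivAt f d t)
    (hd : d < 0) (h0 : f t = 0) : ∀ᶠ s in 𝓝[>] t, f s < 0 := by
  have h := eventually_sign_of_hasDerivAt_pos hf.neg (neg_pos.2 hd) (by simpa using h0)
  filter_upwards [nhdsWithin_le_nhds h, self_mem_nhdsWithin] with s hs hts
  rw [sign_pos (sub_pos.2 hts), sign_eq_one_iff] at hs
  simpa using hs

theorem hasDerivAt_nonpos_of_pos_left {f : ℝ → ℝ} {d a t : ℝ} (hat : a < t)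
    (hf : HasDerivAt f d t) (h0 : f t = 0) (hpos : ∀ s ∈ Ico a t, 0 < f s) : d ≤ 0 := by
  by_contra! hd
  have h : ∀ᶠ s in 𝓝[<] t, SignType.sign (f s) = SignType.sign (s - t) :=
    nhdsWithin_le_nhds (eventually_sign_of_hasDerivAt_pos hf hd h0)
  obtain ⟨s, hs, hs'⟩ := (h.and (Ico_mem_nhdsLT hat)).exists
  rw [sign_neg (sub_neg.2 hs'.2), sign_eq_neg_one_iff] at hs
  exact (hpos s hs').not_gt hs

theorem exists_first_zero {f : ℝ → ℝ} {T : ℝ} (hf : ContinuousOn f (Icc 0 T)) (h0 : 0 < f 0)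
    (hT : ∃ t ∈ Icc 0 T, f t ≤ 0) :
    ∃ τ, 0 < τ ∧ τ ≤ T ∧ f τ = 0 ∧ ∀ t ∈ Ico 0 τ, 0 < f t := by
  have hc : IsCompact (Icc 0 T ∩ f ⁻¹' Iic 0) :=
    (isCompact_Icc (a := (0 : ℝ)) (b := T)).of_isClosed_subset
      (hf.preimage_isClosed_of_isClosed isClosed_Icc isClosed_Iic) inter_subset_left
  obtain ⟨τ, ⟨hτ, hfτ⟩, hmin⟩ := hc.exists_isLeast hT
  have hpos : ∀ t ∈ Ico 0 τ, 0 < f t := fun t ht => by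
    by_contra! h
    exact (hmin ⟨⟨ht.1, ht.2.le.trans hτ.2⟩, h⟩).not_gt ht.2
  have hτ0 : 0 < τ := hτ.1.lt_of_ne (by rintro rfl; exact (not_le.2 h0) hfτ)
  refine ⟨τ, hτ0, hτ.2, le_antisymm hfτ ?_, hpos⟩
  have hcl : τ ∈ closure (Ico 0 τ) := by
    rw [closure_Ico hτ0.ne]; exact ⟨hτ0.le, le_rfl⟩
  have hmem := ((hf τ hτ).mono (Ico_subset_Icc_self.trans (Icc_subset_Icc_right hτ.2))).mem_closure
    hcl (t := Ici 0) (fun t ht => (hpos t ht).le)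
  simpa using hmem

theorem continuous_first_zero {P : Type*} [TopologicalSpace P] {g : P → ℝ → ℝ}
    (hg : Continuous (Function.uncurry g)) {τ : P → ℝ} (hτ : ∀ p, 0 < τ p)
    (h0 : ∀ p, g p (τ p) = 0) (hpos : ∀ p, ∀ t ∈ Ico 0 (τ p), 0 < g p t)
    (hd : ∀ p, ∃ d < 0, HasDerivAt (g p) d (τ p)) : Continuous τ := by
  refine continuous_iff_continuousAt.2 fun p₀ => tendsto_order.2 ⟨fun a ha => ?_, fun b hb => ?_⟩
  · have h : ∀ᶠ p in 𝓝 p₀, ∀ t ∈ Icc 0 a, 0 < g p t :=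
      isCompact_Icc.eventually_forall_of_forall_eventually (P := fun p t => 0 < g p t)
        fun t ht => hg.continuousAt.eventually (lt_mem_nhds (hpos p₀ t ⟨ht.1, ht.2.trans_lt ha⟩))
    filter_upwards [h] with p hp
    by_contra! hle
    exact (hp (τ p) ⟨(hτ p).le, hle⟩).ne' (h0 p)
  · obtain ⟨d, hd0, hdd⟩ := hd p₀
    obtain ⟨t, ht, ht'⟩ := ((eventually_neg_right_of_hasDerivAt_neg hdd hd0 (h0 p₀)).and
      (Ioo_mem_nhdsGT hb)).exists
    have hcont : Continuous fun p => g p t := hg.comp (by fun_prop : Continuous fun p => (p, t))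
    filter_upwards [hcont.continuousAt.eventually (gt_mem_nhds ht)] with p hp
    by_contra! hle
    exact (hpos p t ⟨(hτ p₀).le.trans ht'.1.le, ht'.2.trans_le hle⟩).not_gt hp

/-- The extension of `f` from `[0, L]` satisfying `F (t + L) = -F t`. -/
noncomputable def antiperiodicExtension (L : ℝ) (f : ℝ → ℝ) (t : ℝ) : ℝ :=
  (-1 : ℝ) ^ ⌊t / L⌋ * f (t - ⌊t / L⌋ * L)

section AntiperiodicExtension

variable {L : ℝ} {f f' : ℝ → ℝ}

theorem antiperiodicExtension_eq_of_mem_Ico (hL : 0 < L) (n : ℤ) {t : ℝ}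
    (ht : t ∈ Ico (n * L) ((n + 1) * L)) :
    antiperiodicExtension L f t = (-1 : ℝ) ^ n * f (t - n * L) := by
  have h : ⌊t / L⌋ = n := by
    rw [Int.floor_eq_iff, le_div_iff₀ hL, div_lt_iff₀ hL]
    exact ht
  rw [antiperiodicExtension, h]

theorem antiperiodicExtension_eq_of_mem_Icc (hL : 0 < L) (hf : f L = -f 0) (n : ℤ) {t : ℝ}
    (ht : t ∈ Icc (n * L) ((n + 1) * L)) :
    antiperiodicExtension L f t = (-1 : ℝ) ^ n * f (t - n * L) := by
  rcases ht.2.lt_or_eq with h | rfl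
  · exact antiperiodicExtension_eq_of_mem_Ico hL n ⟨ht.1, h⟩
  · rw [antiperiodicExtension_eq_of_mem_Ico hL (n + 1) (by push_cast; constructor <;> linarith),
      zpow_add_one₀ (by norm_num)]
    push_cast
    rw [show ((n : ℝ) + 1) * L - n * L = L by ring, sub_self, hf]
    ring

theorem exists_mem_Ico_mul (hL : 0 < L) (t : ℝ) : ∃ n : ℤ, t ∈ Ico (n * L) ((n + 1) * L) :=
  ⟨⌊t / L⌋, (le_div_iff₀ hL).1 (Int.floor_le _), (div_lt_iff₀ hL).1 (Int.lt_floor_add_one _)⟩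

theorem exists_mem_Ioc_mul (hL : 0 < L) (t : ℝ) : ∃ n : ℤ, t ∈ Ioc (n * L) ((n + 1) * L) := by
  refine ⟨⌈t / L⌉ - 1, ?_, ?_⟩
  · push_cast
    rw [← lt_div_iff₀ hL]
    linarith [Int.ceil_lt_add_one (t / L)]
  · push_cast
    rw [← div_le_iff₀ hL]
    linarith [Int.le_ceil (t / L)]

theorem continuous_antiperiodicExtension (hL : 0 < L) (hf : f L = -f 0)
    (hc : ∀ t ∈ Icc 0 L, ContinuousAt f t) : Continuous (antiperiodicExtension L f) := by
  have key : ∀ (n : ℤ) (t : ℝ), t ∈ Icc (n * L) ((n + 1) * L) →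
      ContinuousWithinAt (antiperiodicExtension L f) (Icc (n * L) ((n + 1) * L)) t := by
    intro n t ht
    have h : ContinuousAt (fun s => (-1 : ℝ) ^ n * f (s - n * L)) t :=
      continuousAt_const.mul (ContinuousAt.comp' (f := fun s => s - n * L)
        (hc _ ⟨by linarith [ht.1], by linarith [ht.2]⟩) (by fun_prop))
    exact h.continuousWithinAt.congr
      (fun s hs => antiperiodicExtension_eq_of_mem_Icc hL hf n hs)
      (antiperiodicExtension_eq_of_mem_Icc hL hf n ht)
  refine continuous_iff_continuousAt.2 fun t => continuousAt_iff_continuous_left'_right'.2 ⟨?_, ?_⟩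
  · obtain ⟨n, hn⟩ := exists_mem_Ioc_mul hL t
    exact (key n t (Ioc_subset_Icc_self hn)).mono_of_mem_nhdsWithin
      (mem_of_superset (Ioo_mem_nhdsLT hn.1) (Ioo_subset_Icc_self.trans (Icc_subset_Icc_right hn.2)))
  · obtain ⟨n, hn⟩ := exists_mem_Ico_mul hL t
    exact (key n t (Ico_subset_Icc_self hn)).mono_of_mem_nhdsWithin
      (mem_of_superset (Ioo_mem_nhdsGT hn.2) (Ioo_subset_Icc_self.trans (Icc_subset_Icc_left hn.1)))

theorem hasDerivAt_antiperiodicExtension (hL : 0 < L) (hf : f L = -f 0) (hf' : f' L = -f' 0)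
    (hd : ∀ t ∈ Icc 0 L, HasDerivAt f (f' t) t) (t : ℝ) :
    HasDerivAt (antiperiodicExtension L f) (antiperiodicExtension L f' t) t := by
  have key : ∀ (n : ℤ) (t : ℝ), t ∈ Icc (n * L) ((n + 1) * L) →
      HasDerivWithinAt (antiperiodicExtension L f) (antiperiodicExtension L f' t)
        (Icc (n * L) ((n + 1) * L)) t := by
    intro n t ht
    have h : HasDerivAt (fun s => (-1 : ℝ) ^ n * f (s - n * L))
        ((-1 : ℝ) ^ n * f' (t - n * L)) t :=
      ((hd _ ⟨by linarith [ht.1], by linarith [ht.2]⟩).comp_sub_const t (n * L)).const_mul _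
    rw [antiperiodicExtension_eq_of_mem_Icc hL hf' n ht]
    exact h.hasDerivWithinAt.congr
      (fun s hs => antiperiodicExtension_eq_of_mem_Icc hL hf n hs)
      (antiperiodicExtension_eq_of_mem_Icc hL hf n ht)
  have hl : HasDerivWithinAt (antiperiodicExtension L f) (antiperiodicExtension L f' t)
      (Iio t) t := by
    obtain ⟨n, hn⟩ := exists_mem_Ioc_mul hL t
    exact (key n t (Ioc_subset_Icc_self hn)).mono_of_mem_nhdsWithin
      (mem_of_superset (Ioo_mem_nhdsLT hn.1) (Ioo_subset_Icc_self.trans (Icc_subset_Icc_right hn.2)))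
  have hr : HasDerivWithinAt (antiperiodicExtension L f) (antiperiodicExtension L f' t)
      (Ioi t) t := by
    obtain ⟨n, hn⟩ := exists_mem_Ico_mul hL t
    exact (key n t (Ico_subset_Icc_self hn)).mono_of_mem_nhdsWithin
      (mem_of_superset (Ioo_mem_nhdsGT hn.2) (Ioo_subset_Icc_self.trans (Icc_subset_Icc_left hn.1)))
  have h := (hasDerivWithinAt_Iio_iff_Iic.1 hl).union (hasDerivWithinAt_Ioi_iff_Ici.1 hr)
  rwa [Iic_union_Ici, hasDerivWithinAt_univ] at h

theorem antiperiodicExtension_antiperiodic (hL : 0 < L) :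
    Function.Antiperiodic (antiperiodicExtension L f) L := by
  intro t
  obtain ⟨n, hn⟩ := exists_mem_Ico_mul hL t
  rw [antiperiodicExtension_eq_of_mem_Ico hL n hn,
    antiperiodicExtension_eq_of_mem_Ico hL (n + 1)
      (by push_cast; constructor <;> linarith [hn.1, hn.2]),
    zpow_add_one₀ (by norm_num)]
  push_cast
  rw [show t + L - ((n : ℝ) + 1) * L = t - n * L by ring]
  ring

end AntiperiodicExtension

/-- The solution `x`, with `E = x'' + x x'`, of `x''' + x x'' + 2 x' ^ 2 = 0` on `[0, L]`
vanishes exactly at the endpoints, where its slopes are `c` and `-c` and its second derivatives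
are opposite. -/
structure IsHalfOrbit (c L : ℝ) (x y E : ℝ → ℝ) : Prop where
  length_pos : 0 < L
  hasDerivAt_x : ∀ t ∈ Icc 0 L, HasDerivAt x (y t) t
  hasDerivAt_y : ∀ t ∈ Icc 0 L, HasDerivAt y (E t - x t * y t) t
  hasDerivAt_E : ∀ t ∈ Icc 0 L, HasDerivAt E (-y t ^ 2) t
  energy : ∀ t ∈ Icc 0 L, x t * E t - y t ^ 2 / 2 = -c ^ 2 / 2
  x_pos : ∀ t ∈ Ioo 0 L, 0 < x t
  x_zero : x 0 = 0
  x_length : x L = 0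
  y_length : y L = -y 0
  E_length : E L = -E 0

theorem IsHalfOrbit.rescale {c L : ℝ} {x y E : ℝ → ℝ} (h : IsHalfOrbit c L x y E) {k : ℝ}
    (hk : 0 < k) :
    IsHalfOrbit (k ^ 2 * c) (L / k) (fun t => k * x (k * t)) (fun t => k ^ 2 * y (k * t))
      (fun t => k ^ 3 * E (k * t)) := by
  have hL : k * (L / k) = L := by field_simp
  have hmem : ∀ t ∈ Icc 0 (L / k), k * t ∈ Icc 0 L := fun t ht =>
    ⟨mul_nonneg hk.le ht.1, hL ▸ mul_le_mul_of_nonneg_left ht.2 hk.le⟩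
  have hcomp : ∀ {f : ℝ → ℝ} {d t : ℝ} (a : ℝ), HasDerivAt f d (k * t) →
      HasDerivAt (fun s => a * f (k * s)) (a * (d * k)) t := fun a hf =>
    (hf.comp _ (hasDerivAt_const_mul k)).const_mul a
  refine ⟨div_pos h.length_pos hk, fun t ht => ?_, fun t ht => ?_, fun t ht => ?_, fun t ht => ?_,
    fun t ht => ?_, ?_, ?_, ?_, ?_⟩
  · exact (hcomp k (h.hasDerivAt_x _ (hmem t ht))).congr_deriv (by ring)
  · exact (hcomp (k ^ 2) (h.hasDerivAt_y _ (hmem t ht))).congr_deriv (by ring)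
  · exact (hcomp (k ^ 3) (h.hasDerivAt_E _ (hmem t ht))).congr_deriv (by ring)
  · linear_combination k ^ 4 * h.energy _ (hmem t ht)
  · exact mul_pos hk (h.x_pos _ ⟨mul_pos hk ht.1, hL ▸ mul_lt_mul_of_pos_left ht.2 hk⟩)
  · simp [h.x_zero]
  · simp [hL, h.x_length]
  · simp [hL, h.y_length]
  · simp [hL, h.E_length]

theorem IsHalfOrbit.exists_periodic {ω L : ℝ} {x₀ y₀ E₀ : ℝ → ℝ}
    (h : IsHalfOrbit (√2 * ω) L x₀ y₀ E₀) :
    ∃ (T : ℝ) (x : ℝ → ℝ),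
      0 < T ∧
      Function.Periodic x T ∧
      (¬ ∃ c : ℝ, ∀ t : ℝ, x t = c) ∧
      ContDiff ℝ 2 x ∧
      (∀ t : ℝ, x t ≠ 0 →
        DifferentiableAt ℝ (deriv (deriv x)) t ∧
        deriv (deriv (deriv x)) t + |x t| * deriv (deriv x) t
          + 2 * (|x t| / x t) * (deriv x t) ^ 2 = 0) ∧
      (∀ t : ℝ, x t * deriv (deriv x) t - (deriv x t) ^ 2 / 2
          + |x t| * x t * deriv x t = -ω ^ 2) := by
  have hL := h.length_pos
  set z₀ : ℝ → ℝ := fun t => E₀ t - x₀ t * y₀ t with hz₀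
  have hz : ∀ t ∈ Icc 0 L, HasDerivAt z₀ (-2 * y₀ t ^ 2 - x₀ t * z₀ t) t := fun t ht =>
    ((h.hasDerivAt_E t ht).sub ((h.hasDerivAt_x t ht).mul (h.hasDerivAt_y t ht))).congr_deriv
      (by simp only [hz₀]; ring)
  have hxL : x₀ L = -x₀ 0 := by simp [h.x_zero, h.x_length]
  have hzL : z₀ L = -z₀ 0 := by simp [hz₀, h.x_zero, h.x_length, h.E_length]
  set x := antiperiodicExtension L x₀
  set y := antiperiodicExtension L y₀
  set z := antiperiodicExtension L z₀
  have hx : ∀ t, HasDerivAt x (y t) t :=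
    hasDerivAt_antiperiodicExtension hL hxL h.y_length h.hasDerivAt_x
  have hy : ∀ t, HasDerivAt y (z t) t :=
    hasDerivAt_antiperiodicExtension hL h.y_length hzL h.hasDerivAt_y
  have hzc : Continuous z :=
    continuous_antiperiodicExtension hL hzL fun t ht => (hz t ht).continuousAt
  have hdx : deriv x = y := funext fun t => (hx t).deriv
  have hdy : deriv y = z := funext fun t => (hy t).deriv
  have hsq : ∀ n : ℤ, ((-1 : ℝ) ^ n) ^ 2 = 1 := fun n => by
    rw [← zpow_natCast, ← zpow_mul, mul_comm, zpow_mul]; simp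
  have hnonneg : ∀ t ∈ Icc 0 L, 0 ≤ x₀ t := by
    intro t ht
    rcases ht.1.eq_or_lt with rfl | h1
    · exact h.x_zero.ge
    rcases ht.2.eq_or_lt with rfl | h2
    · exact h.x_length.ge
    exact (h.x_pos t ⟨h1, h2⟩).le
  have habs : ∀ n : ℤ, |(-1 : ℝ) ^ n| = 1 := fun n => by simp [abs_zpow]
  refine ⟨2 * L, x, by positivity, ?_, ?_, ?_, ?_, ?_⟩
  · simpa using (antiperiodicExtension_antiperiodic (f := x₀) hL).periodic_two_mul
  · rintro ⟨c, hc⟩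
    have h0 : x 0 = 0 := by
      simpa [h.x_zero] using antiperiodicExtension_eq_of_mem_Ico (f := x₀) (t := 0) hL 0 (by simpa)
    have h1 : x (L / 2) = x₀ (L / 2) := by
      simpa using antiperiodicExtension_eq_of_mem_Ico (f := x₀) (t := L / 2) hL 0
        (by simp; constructor <;> linarith)
    have h2 := h.x_pos (L / 2) ⟨by linarith, by linarith⟩
    rw [← h1, hc, ← hc 0, h0] at h2
    exact h2.false
  · rw [show (2 : WithTop ℕ∞) = 1 + 1 by norm_num, contDiff_succ_iff_deriv, hdx]
    refine ⟨fun t => (hx t).differentiableAt, by simp, ?_⟩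
    rw [contDiff_one_iff_deriv, hdy]
    exact ⟨fun t => (hy t).differentiableAt, hzc⟩
  · intro t ht
    rw [hdx, hdy]
    obtain ⟨n, hn⟩ := exists_mem_Ico_mul hL t
    have hxt : x t = (-1 : ℝ) ^ n * x₀ (t - n * L) :=
      antiperiodicExtension_eq_of_mem_Ico hL n hn
    have hyt : y t = (-1 : ℝ) ^ n * y₀ (t - n * L) :=
      antiperiodicExtension_eq_of_mem_Ico hL n hn
    have hzt : z t = (-1 : ℝ) ^ n * z₀ (t - n * L) :=
      antiperiodicExtension_eq_of_mem_Ico hL n hn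
    have hne : n * L ≠ t := by
      rintro rfl
      simp [hxt, h.x_zero] at ht
    have hlt : n * L < t := hn.1.lt_of_ne hne
    have hpos := h.x_pos (t - n * L) ⟨by linarith, by linarith [hn.2]⟩
    have hd : HasDerivAt z ((-1 : ℝ) ^ n *
        (-2 * y₀ (t - n * L) ^ 2 - x₀ (t - n * L) * z₀ (t - n * L))) t := by
      refine (((hz (t - n * L) ⟨by linarith, by linarith [hn.2]⟩).comp_sub_const t
        (n * L)).const_mul ((-1 : ℝ) ^ n)).congr_of_eventuallyEq ?_
      filter_upwards [Ioo_mem_nhds hlt hn.2] with s hs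
      exact antiperiodicExtension_eq_of_mem_Ico hL n (Ioo_subset_Ico_self hs)
    refine ⟨hd.differentiableAt, ?_⟩
    have hsgn : |x t| / x t = (-1 : ℝ) ^ n := by
      rw [div_eq_iff ht, hxt, abs_mul, habs, abs_of_pos hpos]
      linear_combination (-x₀ (t - n * L)) * hsq n
    rw [hsgn, hd.deriv, hyt, hzt, hxt, abs_mul, habs, abs_of_pos hpos]
    linear_combination 2 * y₀ (t - n * L) ^ 2 * (-1 : ℝ) ^ n * hsq n
  · intro t
    rw [hdx, hdy]
    obtain ⟨n, hn⟩ := exists_mem_Ico_mul hL t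
    have hmem : t - n * L ∈ Icc 0 L := ⟨by linarith [hn.1], by linarith [hn.2]⟩
    have hE := h.energy _ hmem
    have hx0 := hnonneg _ hmem
    have hs2 : √2 ^ 2 = 2 := Real.sq_sqrt (by norm_num)
    simp only [x, y, z, antiperiodicExtension_eq_of_mem_Ico hL n hn, abs_mul, habs,
      abs_of_nonneg hx0, hz₀]
    linear_combination (x₀ (t - n * L) * E₀ (t - n * L) - y₀ (t - n * L) ^ 2 / 2) * hsq n
      + hE - ω ^ 2 / 2 * hs2

theorem exists_flow_of_bounded {V : Type*} [NormedAddCommGroup V] [NormedSpace ℝ V]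
    [CompleteSpace V] {v : V → V} {K M : NNReal} (hK : LipschitzWith K v)
    (hM : ∀ z, ‖v z‖ ≤ M) (r T : NNReal) :
    ∃ α : V → ℝ → V, (∀ z ∈ closedBall (0 : V) r, α z 0 = z ∧
      ∀ t ∈ Icc (-T : ℝ) T, HasDerivWithinAt (α z) (v (α z t)) (Icc (-T : ℝ) T) t) ∧
      ContinuousOn (Function.uncurry α) (closedBall (0 : V) r ×ˢ Icc (-T : ℝ) T) := by
  have hT : (0 : ℝ) ∈ Icc (-T : ℝ) T := ⟨by simp, by simp⟩
  have h : IsPicardLindelof (fun _ => v) (⟨0, hT⟩ : Icc (-T : ℝ) T) 0 (r + M * T) r M K :=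
    { lipschitzOnWith := fun _ _ => hK.lipschitzOnWith
      continuousOn := fun _ _ => continuousOn_const
      norm_le := fun _ _ z _ => hM z
      mul_max_le := by simp }
  obtain ⟨α, hα, hc⟩ := h.exists_forall_mem_closedBall_eq_hasDerivWithinAt_continuousOn
  exact ⟨Function.curry α, hα, hc⟩

/-- A solution through `(p, 1, 0)`, on `(-200, 200)`, of the quadratic system `x' = y`,
`y' = E - x y`, `E' = -y ^ 2` multiplied by a cutoff `χ` equal to `1` on a large cube. -/
structure IsCutoffOrbit (p : ℝ) (x y E χ : ℝ → ℝ) : Prop where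
  x_init : x 0 = p
  y_init : y 0 = 1
  E_init : E 0 = 0
  hasDerivAt_x : ∀ t ∈ Ioo (-200 : ℝ) 200, HasDerivAt x (χ t * y t) t
  hasDerivAt_y : ∀ t ∈ Ioo (-200 : ℝ) 200, HasDerivAt y (χ t * (E t - x t * y t)) t
  hasDerivAt_E : ∀ t ∈ Ioo (-200 : ℝ) 200, HasDerivAt E (χ t * -y t ^ 2) t
  cutoff_nonneg : ∀ t, 0 ≤ χ t
  cutoff_eq_one : ∀ t, |x t| ≤ 100 → |y t| ≤ 100 → |E t| ≤ 100 → χ t = 1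

theorem exists_cutoffOrbit_family :
    ∃ x y E χ : Icc (1 / 10 : ℝ) 4 → ℝ → ℝ,
      Continuous (Function.uncurry x) ∧ Continuous (Function.uncurry E) ∧
      ∀ p : Icc (1 / 10 : ℝ) 4, IsCutoffOrbit (p : ℝ) (x p) (y p) (E p) (χ p) := by
  let b : ContDiffBump (0 : ℝ × ℝ × ℝ) := ⟨100, 101, by norm_num, by norm_num⟩
  let w : ℝ × ℝ × ℝ → ℝ × ℝ × ℝ := fun z => (z.2.1, z.2.2 - z.1 * z.2.1, -z.2.1 ^ 2)
  let v : ℝ × ℝ × ℝ → ℝ × ℝ × ℝ := fun z => b z • w z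
  have hw : ContDiff ℝ 1 w := by fun_prop
  have hv : ContDiff ℝ 1 v := b.contDiff.smul hw
  have hvs : HasCompactSupport v := b.hasCompactSupport.smul_right
  obtain ⟨K, hK⟩ := hv.lipschitzWith_of_hasCompactSupport hvs one_ne_zero
  obtain ⟨M, hM⟩ := hvs.exists_bound_of_continuous hv.continuous
  have hM0 : 0 ≤ M := (norm_nonneg _).trans (hM 0)
  obtain ⟨α, hα, hαc⟩ := exists_flow_of_bounded (M := ⟨M, hM0⟩) hK hM 10 200
  have h200 : (-200 : ℝ) ≤ 200 := by norm_num
  let φ : Icc (1 / 10 : ℝ) 4 → ℝ → ℝ × ℝ × ℝ := fun p t =>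
    α (p, 1, 0) (projIcc (-200) 200 h200 t)
  have hball : ∀ p : Icc (1 / 10 : ℝ) 4, ((p : ℝ), (1 : ℝ), (0 : ℝ)) ∈
      closedBall (0 : ℝ × ℝ × ℝ) (10 : NNReal) := by
    intro p
    have hp := p.2
    simp only [mem_closedBall, dist_zero_right, Prod.norm_def, Real.norm_eq_abs]
    rw [abs_of_pos (by linarith [hp.1])]
    simp
    linarith [hp.2]
  have hφc : Continuous (Function.uncurry φ) := by
    refine hαc.comp_continuous (f := fun q : Icc (1 / 10 : ℝ) 4 × ℝ =>
      (((q.1 : ℝ), (1 : ℝ), (0 : ℝ)), (projIcc (-200 : ℝ) 200 h200 q.2 : ℝ))) ?_ ?_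
    · have := continuous_projIcc (h := h200)
      fun_prop
    · exact fun q => ⟨hball q.1, (projIcc (-200 : ℝ) 200 h200 q.2).2⟩
  have hφ : ∀ p, ∀ t ∈ Ioo (-200 : ℝ) 200, HasDerivAt (φ p) (v (φ p t)) t := by
    intro p t ht
    have heq : ∀ s ∈ Ioo (-200 : ℝ) 200, φ p s = α (p, 1, 0) s := fun s hs => by
      simp only [φ, projIcc_of_mem h200 (Ioo_subset_Icc_self hs)]
    rw [heq t ht]
    refine (((hα _ (hball p)).2 t (Ioo_subset_Icc_self ht)).hasDerivAt
      (Icc_mem_nhds ht.1 ht.2)).congr_of_eventuallyEq ?_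
    filter_upwards [Ioo_mem_nhds ht.1 ht.2] with s hs using heq s hs
  have hφ0 : ∀ p : Icc (1 / 10 : ℝ) 4, φ p 0 = ((p : ℝ), 1, 0) := fun p => by
    simp only [φ, projIcc_of_mem h200 (show (0 : ℝ) ∈ Icc (-200 : ℝ) 200 by norm_num)]
    exact (hα _ (hball p)).1
  refine ⟨fun p t => (φ p t).1, fun p t => (φ p t).2.1, fun p t => (φ p t).2.2,
    fun p t => b (φ p t), hφc.fst, hφc.snd.snd, fun p => ⟨?_, ?_, ?_, ?_, ?_, ?_, ?_, ?_⟩⟩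
  · simp [hφ0]
  · simp [hφ0]
  · simp [hφ0]
  · exact fun t ht => (hφ p t ht).fst
  · exact fun t ht => (hφ p t ht).snd.fst
  · exact fun t ht => (hφ p t ht).snd.snd
  · exact fun t => b.nonneg
  · intro t h1 h2 h3
    refine b.one_of_mem_closedBall ?_
    simpa [Prod.norm_def, b] using ⟨h1, h2, h3⟩

namespace IsCutoffOrbit

variable {p : ℝ} {x y E χ : ℝ → ℝ}

theorem energy (h : IsCutoffOrbit p x y E χ) {t : ℝ} (ht : t ∈ Ioo (-200 : ℝ) 200) :
    y t ^ 2 = 1 + 2 * (x t * E t) := by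
  have hd : ∀ s ∈ Ioo (-200 : ℝ) 200,
      HasDerivAt (fun s => y s ^ 2 - 2 * (x s * E s)) 0 s := fun s hs =>
    (((h.hasDerivAt_y s hs).pow 2).sub
      (((h.hasDerivAt_x s hs).mul (h.hasDerivAt_E s hs)).const_mul 2)).congr_deriv (by
        simp only [Nat.cast_ofNat, Nat.add_one_sub_one, pow_one]; ring)
  have hc := (convex_Ioo (-200 : ℝ) 200).is_const_of_fderivWithin_eq_zero (𝕜 := ℝ)
    (f := fun s => y s ^ 2 - 2 * (x s * E s))
    (fun s hs => (hd s hs).differentiableAt.differentiableWithinAt)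
    (fun s hs => by
      rw [fderivWithin_of_isOpen isOpen_Ioo hs]
      ext
      simp [(hd s hs).deriv]) ht (show (0 : ℝ) ∈ Ioo (-200 : ℝ) 200 by norm_num)
  simp only [h.y_init, h.E_init] at hc
  linarith

theorem E_antitone (h : IsCutoffOrbit p x y E χ) {s t : ℝ} (hs : -200 < s) (hst : s ≤ t)
    (ht : t < 200) : E t ≤ E s :=
  le_of_hasDerivAt_nonpos hst
    (fun u hu => h.hasDerivAt_E u ⟨hs.trans_le hu.1, hu.2.trans_lt ht⟩)
    (fun u _ => by nlinarith [mul_nonneg (h.cutoff_nonneg u) (sq_nonneg (y u))])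

/-- The derivative of `y + x ^ 2 / 2` along the orbit. -/
theorem hasDerivAt_drift (h : IsCutoffOrbit p x y E χ) {t : ℝ} (ht : t ∈ Ioo (-200 : ℝ) 200) :
    HasDerivAt (fun t => y t + x t ^ 2 / 2) (χ t * E t) t :=
  ((h.hasDerivAt_y t ht).add (((h.hasDerivAt_x t ht).pow 2).div_const 2)).congr_deriv (by
    simp only [Nat.cast_ofNat, Nat.add_one_sub_one, pow_one]; ring)

section Forward

theorem E_nonpos (h : IsCutoffOrbit p x y E χ) {t : ℝ} (h0 : 0 ≤ t) (ht : t < 200) : E t ≤ 0 :=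
  h.E_init ▸ h.E_antitone (by norm_num) h0 ht

theorem abs_y_le_one (h : IsCutoffOrbit p x y E χ) {t : ℝ} (h0 : 0 ≤ t) (ht : t < 200)
    (hx : 0 ≤ x t) : |y t| ≤ 1 := by
  rw [← sq_le_one_iff_abs_le_one, h.energy ⟨by linarith, ht⟩]
  nlinarith [mul_nonneg hx (neg_nonneg.2 (h.E_nonpos h0 ht))]

theorem x_sq_le (h : IsCutoffOrbit p x y E χ) {t : ℝ} (h0 : 0 ≤ t) (ht : t < 200)
    (hx : 0 ≤ x t) : x t ^ 2 ≤ p ^ 2 + 4 := by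
  have hm : y t + x t ^ 2 / 2 ≤ y 0 + x 0 ^ 2 / 2 :=
    le_of_hasDerivAt_nonpos (f := fun t => y t + x t ^ 2 / 2) h0
      (fun u hu => h.hasDerivAt_drift ⟨by linarith [hu.1], hu.2.trans_lt ht⟩)
      (fun u hu => mul_nonpos_of_nonneg_of_nonpos (h.cutoff_nonneg u)
        (h.E_nonpos hu.1 (hu.2.trans_lt ht)))
  rw [h.y_init, h.x_init] at hm
  linarith [(abs_le.1 (h.abs_y_le_one h0 ht hx)).1]

theorem E_sq_le (h : IsCutoffOrbit p x y E χ) {t : ℝ} (h0 : 0 ≤ t) (ht : t < 200)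
    (hx : ∀ s ∈ Icc 0 t, 0 ≤ x s) : E t ^ 2 ≤ p ^ 2 + 4 := by
  have hm : E t ^ 2 + 2 * (y t + x t ^ 2 / 2) ≤ E 0 ^ 2 + 2 * (y 0 + x 0 ^ 2 / 2) :=
    le_of_hasDerivAt_nonpos (f := fun t => E t ^ 2 + 2 * (y t + x t ^ 2 / 2))
      (f' := fun t => 2 * (χ t * (E t * (1 - y t ^ 2)))) h0
      (fun u hu => by
        have hu' : u ∈ Ioo (-200 : ℝ) 200 := ⟨by linarith [hu.1], hu.2.trans_lt ht⟩
        refine (((h.hasDerivAt_E u hu').pow 2).add ((h.hasDerivAt_drift hu').const_mul 2)).congr_deriv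
          ?_
        simp only [Nat.cast_ofNat, Nat.add_one_sub_one, pow_one]
        ring)
      (fun u hu => by
        have h1 := (sq_le_one_iff_abs_le_one _).2
          (h.abs_y_le_one hu.1 (hu.2.trans_lt ht) (hx u hu))
        have h2 := mul_nonpos_of_nonpos_of_nonneg (h.E_nonpos hu.1 (hu.2.trans_lt ht))
          (sub_nonneg.2 h1)
        linarith [mul_nonpos_of_nonneg_of_nonpos (h.cutoff_nonneg u) h2])
  rw [h.y_init, h.x_init, h.E_init] at hm
  nlinarith [(abs_le.1 (h.abs_y_le_one h0 ht (hx t ⟨h0, le_rfl⟩))).1, sq_nonneg (x t)]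

theorem cutoff_eq_one_forward (h : IsCutoffOrbit p x y E χ) (hp : p ∈ Icc (1 / 10 : ℝ) 4) {t : ℝ}
    (h0 : 0 ≤ t) (ht : t < 200) (hx : ∀ s ∈ Icc 0 t, 0 ≤ x s) : χ t = 1 := by
  have hp2 : p ^ 2 ≤ 16 := by nlinarith [hp.1, hp.2]
  have hxt := hx t ⟨h0, le_rfl⟩
  refine h.cutoff_eq_one t (abs_le_of_sq_le_sq ?_ (by norm_num))
    ((h.abs_y_le_one h0 ht hxt).trans (by norm_num)) (abs_le_of_sq_le_sq ?_ (by norm_num))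
  · linarith [h.x_sq_le h0 ht hxt]
  · linarith [h.E_sq_le h0 ht hx]

theorem exists_forward_zero (h : IsCutoffOrbit p x y E χ) (hp : p ∈ Icc (1 / 10 : ℝ) 4) :
    ∃ τ, 0 < τ ∧ τ < 200 ∧ x τ = 0 ∧ ∀ t ∈ Ico 0 τ, 0 < x t := by
  have hp0 : 0 < p := by linarith [hp.1]
  have hp2 : p ^ 2 ≤ 16 := by nlinarith [hp.1, hp.2]
  have hlt : ∀ {t : ℝ}, t ∈ Icc (0 : ℝ) 110 → t < 200 := fun ht => ht.2.trans_lt (by norm_num)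
  obtain ⟨τ, h1, h2, h3, h4⟩ := exists_first_zero (f := x) (T := 110)
    (fun t ht => (h.hasDerivAt_x t ⟨by linarith [ht.1], hlt ht⟩).continuousAt.continuousWithinAt)
    (by rwa [h.x_init]) (by
      by_contra! hpos
      have hnn : ∀ t ∈ Icc (0 : ℝ) 110, ∀ s ∈ Icc 0 t, 0 ≤ x s := fun t ht s hs =>
        (hpos s ⟨hs.1, hs.2.trans ht.2⟩).le
      have hm := le_of_hasDerivAt_nonneg (f := fun t => -E t - 10 * (y t + x t ^ 2 / 2) - t)
        (f' := fun t => y t ^ 2 - 10 * E t - 1) (a := 0) (b := 110) (by norm_num)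
        (fun u hu => by
          have hu' : u ∈ Ioo (-200 : ℝ) 200 := ⟨by linarith [hu.1], hlt hu⟩
          have hχ := h.cutoff_eq_one_forward hp hu.1 (hlt hu) (hnn u hu)
          refine (((h.hasDerivAt_E u hu').neg.sub ((h.hasDerivAt_drift hu').const_mul 10)).sub
            (hasDerivAt_id u)).congr_deriv ?_
          rw [hχ]
          ring)
        (fun u hu => by
          have hxu := hpos u hu
          have h5 : x u ≤ 5 := by
            nlinarith [h.x_sq_le hu.1 (hlt hu) hxu.le]
          rw [h.energy ⟨by linarith [hu.1], hlt hu⟩]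
          nlinarith [mul_nonneg (sub_nonneg.2 h5) (neg_nonneg.2 (h.E_nonpos hu.1 (hlt hu)))])
      have hmem : (110 : ℝ) ∈ Icc (0 : ℝ) 110 := by norm_num
      have hE : |E 110| ≤ 5 := abs_le_of_sq_le_sq
        (by linarith [h.E_sq_le hmem.1 (hlt hmem) (hnn _ hmem)]) (by norm_num)
      have hy := h.abs_y_le_one hmem.1 (hlt hmem) (hpos _ hmem).le
      simp only [h.y_init, h.x_init, h.E_init] at hm
      nlinarith [(abs_le.1 hE).1, (abs_le.1 hy).1, sq_nonneg (x 110)])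
  exact ⟨τ, h1, h2.trans_lt (by norm_num), h3, h4⟩

theorem y_eq_neg_one (h : IsCutoffOrbit p x y E χ) {τ : ℝ} (h0 : 0 < τ) (hτ : τ < 200)
    (hx : x τ = 0) (hpos : ∀ t ∈ Ico 0 τ, 0 < x t) (hχ : χ τ = 1) : y τ = -1 := by
  have hmem : τ ∈ Ioo (-200 : ℝ) 200 := ⟨by linarith, hτ⟩
  have hy := hasDerivAt_nonpos_of_pos_left h0 (h.hasDerivAt_x τ hmem) hx hpos
  have he := h.energy hmem
  rw [hχ, one_mul] at hy
  rw [hx, zero_mul, mul_zero, add_zero] at he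
  nlinarith

theorem E_le_neg_of_zero (h : IsCutoffOrbit (1 / 10) x y E χ) {τ : ℝ}
    (h0 : 0 < τ) (hτ : τ < 200) (hpos : ∀ t ∈ Ico 0 τ, 0 < x t) (hy : y τ = -1) :
    E τ ≤ -1 / 5 := by
  obtain ⟨t, ht, hyt⟩ := intermediate_value_Icc' (f := y) h0.le
    (fun t ht => (h.hasDerivAt_y t
      ⟨by linarith [ht.1], ht.2.trans_lt hτ⟩).continuousAt.continuousWithinAt)
    (show (0 : ℝ) ∈ Icc (y τ) (y 0) by rw [hy, h.y_init]; norm_num)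
  have hne : t ≠ τ := by
    rintro rfl
    linarith
  have hxt := hpos t ⟨ht.1, ht.2.lt_of_ne hne⟩
  have ht200 : t < 200 := ht.2.trans_lt hτ
  have he := h.energy ⟨by linarith [ht.1], ht200⟩
  rw [hyt] at he
  have hx3 : x t ≤ 5 / 2 := by nlinarith [h.x_sq_le ht.1 ht200 hxt.le]
  have := h.E_antitone (by linarith [ht.1]) ht.2 hτ
  nlinarith [h.E_nonpos ht.1 ht200]

end Forward

section Backward

theorem E_nonneg (h : IsCutoffOrbit p x y E χ) {t : ℝ} (ht : -200 < t) (h0 : t ≤ 0) : 0 ≤ E t :=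
  h.E_init ▸ h.E_antitone ht h0 (by norm_num)

theorem one_le_y (h : IsCutoffOrbit p x y E χ) {t : ℝ} (ht : -200 < t) (h0 : t ≤ 0)
    (hx : ∀ s ∈ Icc t 0, 0 ≤ x s) : 1 ≤ y t := by
  have hmem : ∀ s ∈ Icc t 0, s ∈ Ioo (-200 : ℝ) 200 := fun s hs =>
    ⟨ht.trans_le hs.1, hs.2.trans_lt (by norm_num)⟩
  have hsq : ∀ s ∈ Icc t 0, 1 ≤ y s ^ 2 := fun s hs => by
    rw [h.energy (hmem s hs)]
    linarith [mul_nonneg (hx s hs) (h.E_nonneg (ht.trans_le hs.1) hs.2)]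
  by_contra! hlt
  have hneg : y t ≤ 0 := by nlinarith [hsq t ⟨le_rfl, h0⟩]
  obtain ⟨s, hs, hys⟩ := intermediate_value_Icc (f := y) h0
    (fun s hs => (h.hasDerivAt_y s (hmem s hs)).continuousAt.continuousWithinAt)
    (show (0 : ℝ) ∈ Icc (y t) (y 0) from ⟨hneg, by rw [h.y_init]; norm_num⟩)
  have := hsq s hs
  rw [hys] at this
  norm_num at this

theorem y_le (h : IsCutoffOrbit p x y E χ) {t : ℝ} (ht : -200 < t) (h0 : t ≤ 0) :
    y t ≤ 1 + p ^ 2 / 2 := by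
  have hm : y t + x t ^ 2 / 2 ≤ y 0 + x 0 ^ 2 / 2 :=
    le_of_hasDerivAt_nonneg (f := fun t => y t + x t ^ 2 / 2) h0
      (fun u hu => h.hasDerivAt_drift ⟨ht.trans_le hu.1, hu.2.trans_lt (by norm_num)⟩)
      (fun u hu => mul_nonneg (h.cutoff_nonneg u) (h.E_nonneg (ht.trans_le hu.1) hu.2))
  rw [h.y_init, h.x_init] at hm
  linarith [sq_nonneg (x t)]

theorem x_le (h : IsCutoffOrbit p x y E χ) {t : ℝ} (ht : -200 < t) (h0 : t ≤ 0)
    (hx : ∀ s ∈ Icc t 0, 0 ≤ x s) : x t ≤ p :=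
  h.x_init ▸ le_of_hasDerivAt_nonneg h0
    (fun u hu => h.hasDerivAt_x u ⟨ht.trans_le hu.1, hu.2.trans_lt (by norm_num)⟩)
    (fun u hu => mul_nonneg (h.cutoff_nonneg u) (zero_le_one.trans
      (h.one_le_y (ht.trans_le hu.1) hu.2 fun s hs => hx s ⟨hu.1.trans hs.1, hs.2⟩)))

theorem E_le (h : IsCutoffOrbit p x y E χ) {t : ℝ} (ht : -200 < t) (h0 : t ≤ 0)
    (hx : ∀ s ∈ Icc t 0, 0 ≤ x s) : E t ≤ (1 + p ^ 2 / 2) * p := by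
  have hm := le_of_hasDerivAt_nonneg (f := fun t => E t + (1 + p ^ 2 / 2) * x t)
    (f' := fun t => χ t * (y t * (1 + p ^ 2 / 2 - y t))) h0
    (fun u hu => by
      have hu' : u ∈ Ioo (-200 : ℝ) 200 := ⟨ht.trans_le hu.1, hu.2.trans_lt (by norm_num)⟩
      exact ((h.hasDerivAt_E u hu').add ((h.hasDerivAt_x u hu').const_mul _)).congr_deriv (by ring))
    (fun u hu => mul_nonneg (h.cutoff_nonneg u) (mul_nonneg (zero_le_one.trans
      (h.one_le_y (ht.trans_le hu.1) hu.2 fun s hs => hx s ⟨hu.1.trans hs.1, hs.2⟩))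
      (sub_nonneg.2 (h.y_le (ht.trans_le hu.1) hu.2))))
  simp only [h.E_init, h.x_init] at hm
  nlinarith [mul_nonneg (hx t ⟨le_rfl, h0⟩) (sq_nonneg p), hx t ⟨le_rfl, h0⟩]

theorem cutoff_eq_one_backward (h : IsCutoffOrbit p x y E χ) (hp : p ∈ Icc (1 / 10 : ℝ) 4) {t : ℝ}
    (ht : -200 < t) (h0 : t ≤ 0) (hx : ∀ s ∈ Icc t 0, 0 ≤ x s) : χ t = 1 := by
  have hp0 : 0 < p := by linarith [hp.1]
  have hp2 : p ^ 2 ≤ 16 := by nlinarith [hp.1, hp.2]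
  refine h.cutoff_eq_one t ?_ ?_ ?_
  · rw [abs_of_nonneg (hx t ⟨le_rfl, h0⟩)]
    linarith [h.x_le ht h0 hx, hp.2]
  · rw [abs_of_nonneg (zero_le_one.trans (h.one_le_y ht h0 hx))]
    linarith [h.y_le ht h0]
  · rw [abs_of_nonneg (h.E_nonneg ht h0)]
    nlinarith [h.E_le ht h0 hx, hp.2]

theorem sub_x_le_E (h : IsCutoffOrbit p x y E χ) {t : ℝ} (ht : -200 < t) (h0 : t ≤ 0)
    (hx : ∀ s ∈ Icc t 0, 0 ≤ x s) : p - x t ≤ E t := by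
  have hm := le_of_hasDerivAt_nonpos (f := fun t => E t + x t)
    (f' := fun t => χ t * (y t * (1 - y t))) h0
    (fun u hu => by
      have hu' : u ∈ Ioo (-200 : ℝ) 200 := ⟨ht.trans_le hu.1, hu.2.trans_lt (by norm_num)⟩
      exact ((h.hasDerivAt_E u hu').add (h.hasDerivAt_x u hu')).congr_deriv (by ring))
    (fun u hu => by
      have hy := h.one_le_y (ht.trans_le hu.1) hu.2 fun s hs => hx s ⟨hu.1.trans hs.1, hs.2⟩
      exact mul_nonpos_of_nonneg_of_nonpos (h.cutoff_nonneg u)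
        (mul_nonpos_of_nonneg_of_nonpos (zero_le_one.trans hy) (sub_nonpos.2 hy)))
  simp only [h.E_init, h.x_init] at hm
  linarith

theorem le_E_of_zero (h : IsCutoffOrbit 4 x y E χ) {t : ℝ} (ht : -200 < t) (h0 : t ≤ 0)
    (hx : ∀ s ∈ Icc t 0, 0 ≤ x s) (hxt : x t = 0) : 28 / 3 ≤ E t := by
  have hm := le_of_hasDerivAt_nonpos (f := fun t => E t + (x t + x t ^ 2 - x t ^ 3 / 6))
    (f' := fun t => χ t * (y t * (1 + x t * (4 - x t) / 2 - y t))) h0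
    (fun u hu => by
      have hu' : u ∈ Ioo (-200 : ℝ) 200 := ⟨ht.trans_le hu.1, hu.2.trans_lt (by norm_num)⟩
      have hxu := h.hasDerivAt_x u hu'
      refine ((h.hasDerivAt_E u hu').add
        ((hxu.add (hxu.pow 2)).sub ((hxu.pow 3).div_const 6))).congr_deriv ?_
      simp only [Nat.cast_ofNat, Nat.add_one_sub_one, pow_one]
      ring)
    (fun u hu => by
      have hu' : u ∈ Ioo (-200 : ℝ) 200 := ⟨ht.trans_le hu.1, hu.2.trans_lt (by norm_num)⟩
      have hxs : ∀ s ∈ Icc u 0, 0 ≤ x s := fun s hs => hx s ⟨hu.1.trans hs.1, hs.2⟩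
      have hy := h.one_le_y hu'.1 hu.2 hxs
      have hxu := hx u hu
      have hw : 0 ≤ x u * (4 - x u) := mul_nonneg hxu (sub_nonneg.2 (h.x_le hu'.1 hu.2 hxs))
      have hw4 : x u * (4 - x u) ≤ 4 := by nlinarith [sq_nonneg (x u - 2)]
      have hyu : 1 + x u * (4 - x u) / 2 ≤ y u := by
        refine le_of_sq_le_sq ?_ (zero_le_one.trans hy)
        rw [h.energy hu']
        nlinarith [mul_le_mul_of_nonneg_left (h.sub_x_le_E hu'.1 hu.2 hxs) hxu,
          mul_nonneg hw (sub_nonneg.2 hw4)]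
      exact mul_nonpos_of_nonneg_of_nonpos (h.cutoff_nonneg u)
        (mul_nonpos_of_nonneg_of_nonpos (zero_le_one.trans hy) (sub_nonpos.2 hyu)))
  simp only [h.E_init, h.x_init, hxt] at hm
  linarith

theorem exists_backward_zero (h : IsCutoffOrbit p x y E χ) (hp : p ∈ Icc (1 / 10 : ℝ) 4) :
    ∃ σ, 0 < σ ∧ σ < 200 ∧ x (-σ) = 0 ∧ ∀ s ∈ Ico 0 σ, 0 < x (-s) := by
  have hlt : ∀ {t : ℝ}, t ∈ Icc (-5 : ℝ) 0 → t ∈ Ioo (-200 : ℝ) 200 := fun ht =>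
    ⟨by linarith [ht.1], by linarith [ht.2]⟩
  obtain ⟨σ, h1, h2, h3, h4⟩ := exists_first_zero (f := fun s => x (-s)) (T := 5)
    (fun s hs => (ContinuousAt.comp' (f := fun s : ℝ => -s) (h.hasDerivAt_x (-s)
      (hlt ⟨by linarith [hs.2], by linarith [hs.1]⟩)).continuousAt
      (by fun_prop)).continuousWithinAt)
    (by rw [neg_zero, h.x_init]; linarith [hp.1]) (by
      by_contra! hpos
      have hpos' : ∀ t ∈ Icc (-5 : ℝ) 0, 0 ≤ x t := fun t ht => by
        simpa using (hpos (-t) ⟨by linarith [ht.2], by linarith [ht.1]⟩).le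
      have hm := le_of_hasDerivAt_nonneg (f := fun t => x t - t) (f' := fun t => y t - 1)
        (a := -5) (b := 0) (by norm_num)
        (fun u hu => by
          refine ((h.hasDerivAt_x u (hlt hu)).sub (hasDerivAt_id u)).congr_deriv ?_
          rw [h.cutoff_eq_one_backward hp (hlt hu).1 hu.2
            fun s hs => hpos' s ⟨hu.1.trans hs.1, hs.2⟩, one_mul])
        (fun u hu => sub_nonneg.2 (h.one_le_y (hlt hu).1 hu.2
          fun s hs => hpos' s ⟨hu.1.trans hs.1, hs.2⟩))
      simp only [h.x_init] at hm
      linarith [hpos' (-5) (by norm_num), hp.2])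
  exact ⟨σ, h1, h2.trans_lt (by norm_num), h3, h4⟩

end Backward

end IsCutoffOrbit

theorem exists_isHalfOrbit : ∃ (L : ℝ) (x y E : ℝ → ℝ), IsHalfOrbit 1 L x y E := by
  obtain ⟨x, y, E, χ, hxc, hEc, h⟩ := exists_cutoffOrbit_family
  choose τ hτ0 hτ hxτ hposτ using fun p => (h p).exists_forward_zero p.2
  choose σ hσ0 hσ hxσ hposσ using fun p => (h p).exists_backward_zero p.2
  have hσmem : ∀ p, -σ p ∈ Ioo (-200 : ℝ) 200 := fun p =>
    ⟨by linarith [hσ p], by linarith [hσ0 p]⟩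
  have hτmem : ∀ p, τ p ∈ Ioo (-200 : ℝ) 200 := fun p => ⟨by linarith [hτ0 p], hτ p⟩
  have hpos : ∀ p, ∀ t ∈ Ioo (-σ p) (τ p), 0 < x p t := fun p t ht => by
    rcases le_total 0 t with h0 | h0
    · exact hposτ p t ⟨h0, ht.2⟩
    · simpa using hposσ p (-t) ⟨by linarith, by linarith [ht.1]⟩
  have hnn : ∀ p, ∀ t ∈ Icc (-σ p) (τ p), 0 ≤ x p t := fun p t ht => by
    rcases ht.1.eq_or_lt with rfl | h1
    · exact (hxσ p).ge
    rcases ht.2.eq_or_lt with rfl | h2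
    · exact (hxτ p).ge
    exact (hpos p t ⟨h1, h2⟩).le
  have hback : ∀ p, ∀ s ∈ Icc (-σ p) 0, 0 ≤ x p s := fun p s hs =>
    hnn p s ⟨hs.1, hs.2.trans (hτ0 p).le⟩
  have hχ : ∀ p, ∀ t ∈ Icc (-σ p) (τ p), χ p t = 1 := fun p t ht => by
    rcases le_total 0 t with h0 | h0
    · exact (h p).cutoff_eq_one_forward p.2 h0 (ht.2.trans_lt (hτ p))
        fun s hs => hnn p s ⟨by linarith [hσ0 p, hs.1], hs.2.trans ht.2⟩
    · exact (h p).cutoff_eq_one_backward p.2 ((hσmem p).1.trans_le ht.1) h0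
        fun s hs => hback p s ⟨ht.1.trans hs.1, hs.2⟩
  have hle : ∀ p, -σ p ≤ τ p := fun p => by linarith [hσ0 p, hτ0 p]
  have hyτ : ∀ p, y p (τ p) = -1 := fun p =>
    (h p).y_eq_neg_one (hτ0 p) (hτ p) (hxτ p) (hposτ p) (hχ p _ ⟨hle p, le_rfl⟩)
  have hyσ : ∀ p, y p (-σ p) = 1 := fun p => by
    have h1 := (h p).one_le_y (hσmem p).1 (by linarith [hσ0 p]) (hback p)
    have h2 := (h p).energy (hσmem p)
    rw [hxσ p] at h2
    nlinarith
  have hτc : Continuous τ := continuous_first_zero hxc hτ0 hxτ hposτ fun p =>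
    ⟨-1, by norm_num, ((h p).hasDerivAt_x _ (hτmem p)).congr_deriv (by
      rw [hχ p _ ⟨hle p, le_rfl⟩, hyτ p, one_mul])⟩
  have hσc : Continuous σ := by
    refine continuous_first_zero (g := fun p s => x p (-s))
      (hxc.comp (by fun_prop : Continuous fun q : Icc (1 / 10 : ℝ) 4 × ℝ => (q.1, -q.2)))
      hσ0 hxσ hposσ fun p => ⟨-1, by norm_num, ?_⟩
    refine (((h p).hasDerivAt_x _ (hσmem p)).comp (σ p) (hasDerivAt_neg (σ p))).congr_deriv ?_
    rw [hχ p _ ⟨le_rfl, hle p⟩, hyσ p]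
    norm_num
  have hDc : Continuous fun p => E p (-σ p) + E p (τ p) :=
    (hEc.comp (continuous_id.prodMk hσc.neg)).add (hEc.comp (continuous_id.prodMk hτc))
  have : PreconnectedSpace (Icc (1 / 10 : ℝ) 4) := Subtype.preconnectedSpace isPreconnected_Icc
  obtain ⟨p, hp⟩ : (0 : ℝ) ∈ range fun p => E p (-σ p) + E p (τ p) := by
    refine intermediate_value_univ (⟨1 / 10, by norm_num⟩ : Icc (1 / 10 : ℝ) 4)
      ⟨4, by norm_num⟩ hDc ⟨?_, ?_⟩
    · set p : Icc (1 / 10 : ℝ) 4 := ⟨1 / 10, by norm_num⟩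
      have hσE := (h p).E_le (hσmem p).1 (by linarith [hσ0 p]) (hback p)
      have hτE := (h p).E_le_neg_of_zero (hτ0 p) (hτ p) (hposτ p) (hyτ p)
      simp only [p] at hσE hτE ⊢
      linarith
    · set p : Icc (1 / 10 : ℝ) 4 := ⟨4, by norm_num⟩
      have hσE := (h p).le_E_of_zero (hσmem p).1 (by linarith [hσ0 p]) (hback p) (hxσ p)
      have hτE : |E p (τ p)| ≤ 5 := abs_le_of_sq_le_sq
        (((h p).E_sq_le (hτ0 p).le (hτ p)
          fun s hs => hnn p s ⟨by linarith [hσ0 p, hs.1], hs.2⟩).trans (by norm_num [p]))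
        (by norm_num)
      linarith [(abs_le.1 hτE).1]
  have hp' : E p (-σ p) + E p (τ p) = 0 := hp
  have hshift : ∀ t ∈ Icc 0 (σ p + τ p), t - σ p ∈ Icc (-σ p) (τ p) := fun t ht =>
    ⟨by linarith [ht.1], by linarith [ht.2]⟩
  have hmem : ∀ t ∈ Icc 0 (σ p + τ p), t - σ p ∈ Ioo (-200 : ℝ) 200 := fun t ht =>
    ⟨(hσmem p).1.trans_le (hshift t ht).1, (hshift t ht).2.trans_lt (hτ p)⟩
  have hend : σ p + τ p - σ p = τ p := by ring
  refine ⟨σ p + τ p, fun t => x p (t - σ p), fun t => y p (t - σ p), fun t => E p (t - σ p),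
    by linarith [hσ0 p, hτ0 p], fun t ht => ?_, fun t ht => ?_, fun t ht => ?_, fun t ht => ?_,
    fun t ht => ?_, ?_, ?_, ?_, ?_⟩
  · exact (((h p).hasDerivAt_x _ (hmem t ht)).comp_sub_const t (σ p)).congr_deriv (by
      rw [hχ p _ (hshift t ht), one_mul])
  · exact (((h p).hasDerivAt_y _ (hmem t ht)).comp_sub_const t (σ p)).congr_deriv (by
      rw [hχ p _ (hshift t ht), one_mul])
  · exact (((h p).hasDerivAt_E _ (hmem t ht)).comp_sub_const t (σ p)).congr_deriv (by
      rw [hχ p _ (hshift t ht), one_mul])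
  · linarith [(h p).energy (hmem t ht)]
  · exact hpos p _ ⟨by linarith [ht.1], by linarith [ht.2]⟩
  · simpa using hxσ p
  · simpa [hend] using hxτ p
  · simp [hend, hyτ p, hyσ p]
  · simp only [hend, zero_sub]
    linarith

/-- For `q = 1` and `k = 2`, the generalized Chazy equation
`x''' + |x| x'' + 2 (|x|/x) x'^2 = 0` has, on each negative energy level
`H = x x'' - x'^2/2 + |x| x x' = -ω^2`, a nonconstant periodic solution. -/
theorem chazy_q1_periodic_orbits :
    ∀ ω : ℝ, 0 < ω →
      ∃ (T : ℝ) (x : ℝ → ℝ),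
        0 < T ∧
        Function.Periodic x T ∧
        (¬ ∃ c : ℝ, ∀ t : ℝ, x t = c) ∧
        ContDiff ℝ 2 x ∧
        (∀ t : ℝ, x t ≠ 0 →
          DifferentiableAt ℝ (deriv (deriv x)) t ∧
          deriv (deriv (deriv x)) t + |x t| * deriv (deriv x) t
            + 2 * (|x t| / x t) * (deriv x t) ^ 2 = 0) ∧
        (∀ t : ℝ, x t * deriv (deriv x) t - (deriv x t) ^ 2 / 2
            + |x t| * x t * deriv x t = -ω ^ 2) := by
  intro ω hω
  obtain ⟨L, x, y, E, h⟩ := exists_isHalfOrbit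
  have hpos : 0 < √2 * ω := by positivity
  have h' := h.rescale (Real.sqrt_pos.2 hpos)
  rw [Real.sq_sqrt hpos.le, mul_one] at h'
  exact h'.exists_periodic
end

section
/- For every real ω > 0 there exist T > 0 and a nonconstant T-periodic function x : ℝ → ℝ of class C³ such that x'''(t) + x(t)²·x''(t) + 3·x(t)·x'(t)² = 0 for all t ∈ ℝ and x(t)·x''(t) − x'(t)²/2 + x(t)³·x'(t) = −ω² for all t ∈ ℝ. (This expresses that for q = 2 and k = q + 1 = 3 the generalized Chazy differential equation has, on each negative energy level H = −ω², a periodic orbit; the union of these orbits over ω > 0 is an invariant topological cylinder foliated by periodic orbits.) -/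
open Set Filter Topology
open scoped NNReal

theorem monotoneOn_Icc_of_hasDerivAt {f f' : ℝ → ℝ} {a b : ℝ}
    (hf : ∀ t ∈ Icc a b, HasDerivAt f (f' t) t) (h : ∀ t ∈ Icc a b, 0 ≤ f' t) :
    MonotoneOn f (Icc a b) := by
  refine monotoneOn_of_deriv_nonneg (convex_Icc a b)
    (fun t ht => (hf t ht).continuousAt.continuousWithinAt) ?_ ?_ <;> rw [interior_Icc]
  · exact fun t ht => (hf t (Ioo_subset_Icc_self ht)).differentiableAt.differentiableWithinAt
  · intro t ht
    rw [(hf t (Ioo_subset_Icc_self ht)).deriv]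
    exact h t (Ioo_subset_Icc_self ht)

theorem exists_first_zero_s1 {f : ℝ → ℝ} {a b : ℝ} (hab : a ≤ b) (hf : ContinuousOn f (Icc a b))
    (ha : 0 < f a) (hb : f b ≤ 0) :
    ∃ t ∈ Icc a b, f t = 0 ∧ ∀ s ∈ Icc a t, 0 ≤ f s := by
  have hK : IsCompact (Icc a b ∩ f ⁻¹' Iic 0) :=
    isCompact_Icc.of_isClosed_subset (hf.preimage_isClosed_of_isClosed isClosed_Icc isClosed_Iic)
      inter_subset_left
  obtain ⟨t, ⟨ht, hft⟩, hmin⟩ := hK.exists_isLeast ⟨b, right_mem_Icc.2 hab, hb⟩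
  have hpos : ∀ s ∈ Icc a b, s < t → 0 < f s := by
    intro s hs hst
    by_contra! h
    exact hst.not_ge (hmin ⟨hs, h⟩)
  have hzero : f t = 0 := by
    obtain ⟨r, hr, hfr⟩ := intermediate_value_Icc' ht.1 (hf.mono (Icc_subset_Icc_right ht.2))
      ⟨hft, ha.le⟩
    rcases hr.2.lt_or_eq with h | h
    · exact absurd hfr (hpos r ⟨hr.1, hr.2.trans ht.2⟩ h).ne'
    · rwa [← h]
  refine ⟨t, ht, hzero, fun s hs => ?_⟩
  rcases hs.2.lt_or_eq with h | h
  · exact (hpos s ⟨hs.1, hs.2.trans ht.2⟩ h).le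
  · rw [h, hzero]

/-- Time change which turns the polar angle of `(y + x ^ 3 / 2, x)` into the time variable. -/
noncomputable def chazySpeed (c x y : ℝ) : ℝ := 2 * (x ^ 2 + (y + x ^ 3 / 2) ^ 2) / (y ^ 2 + c ^ 2)

/-- A solution on `[0, s]` of the time-changed system `x' = y`, `y' = w - x ^ 2 y`, `w' = -x y ^ 2`
starting from `(0, c, a)`. -/
structure IsChazyArc (c a s : ℝ) (x y w : ℝ → ℝ) : Prop where
  x_zero : x 0 = 0
  y_zero : y 0 = c
  w_zero : w 0 = a
  hasDerivAt_x : ∀ t ∈ Icc 0 s, HasDerivAt x (chazySpeed c (x t) (y t) * y t) t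
  hasDerivAt_y : ∀ t ∈ Icc 0 s,
    HasDerivAt y (chazySpeed c (x t) (y t) * (w t - x t ^ 2 * y t)) t
  hasDerivAt_w : ∀ t ∈ Icc 0 s, HasDerivAt w (chazySpeed c (x t) (y t) * -(x t * y t ^ 2)) t

theorem chazySpeed_nonneg (c x y : ℝ) : 0 ≤ chazySpeed c x y := by
  unfold chazySpeed; positivity

theorem chazySpeed_pos {c x y : ℝ} (hc : 0 < c) (h : x = 0 → y ≠ 0) : 0 < chazySpeed c x y := by
  unfold chazySpeed
  have : 0 < x ^ 2 + (y + x ^ 3 / 2) ^ 2 := by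
    by_cases hx : x = 0
    · subst hx
      have := h rfl
      have : 0 < y ^ 2 := by positivity
      nlinarith
    · positivity
  positivity

namespace IsChazyArc

variable {c a s : ℝ} {x y w : ℝ → ℝ}

theorem continuousOn_x (h : IsChazyArc c a s x y w) : ContinuousOn x (Icc 0 s) :=
  fun t ht => (h.hasDerivAt_x t ht).continuousAt.continuousWithinAt

theorem continuousOn_y (h : IsChazyArc c a s x y w) : ContinuousOn y (Icc 0 s) :=
  fun t ht => (h.hasDerivAt_y t ht).continuousAt.continuousWithinAt

theorem continuousOn_w (h : IsChazyArc c a s x y w) : ContinuousOn w (Icc 0 s) :=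
  fun t ht => (h.hasDerivAt_w t ht).continuousAt.continuousWithinAt

theorem energy (h : IsChazyArc c a s x y w) {t : ℝ} (ht : t ∈ Icc 0 s) :
    y t ^ 2 = c ^ 2 + 2 * (x t * w t) := by
  have hd : ∀ r ∈ Icc 0 s, HasDerivAt (fun r => y r ^ 2 - 2 * (x r * w r)) 0 r := by
    intro r hr
    refine (((h.hasDerivAt_y r hr).pow 2).sub
      (((h.hasDerivAt_x r hr).mul (h.hasDerivAt_w r hr)).const_mul 2)).congr_deriv ?_
    push_cast
    ring
  have := constant_of_has_deriv_right_zero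
    (fun r hr => (hd r hr).continuousAt.continuousWithinAt)
    (fun r hr => (hd r (Ico_subset_Icc_self hr)).hasDerivWithinAt) t ht
  simp only [h.x_zero, h.y_zero] at this
  linarith

theorem ne_zero (h : IsChazyArc c a s x y w) (hc : 0 < c) {t : ℝ} (ht : t ∈ Icc 0 s)
    (hx : x t = 0) : y t ≠ 0 := by
  intro hy
  have := h.energy ht
  rw [hx, hy] at this
  nlinarith

theorem speed_pos (h : IsChazyArc c a s x y w) (hc : 0 < c) {t : ℝ} (ht : t ∈ Icc 0 s) :
    0 < chazySpeed c (x t) (y t) :=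
  chazySpeed_pos hc (h.ne_zero hc ht)

theorem exists_polar (h : IsChazyArc c a s x y w) (hc : 0 < c) {t : ℝ} (ht : t ∈ Icc 0 s) :
    ∃ B, 0 < B ∧ x t = B * Real.sin t ∧ y t + x t ^ 3 / 2 = B * Real.cos t := by
  set q : ℝ → ℝ := fun r => y r + x r ^ 3 / 2 with hq
  set α : ℝ → ℝ := fun r =>
    2 * (x r * y r + q r * (w r + x r ^ 2 * y r / 2)) / (y r ^ 2 + c ^ 2) with hα
  have hcx := h.continuousOn_x
  have hcy := h.continuousOn_y
  have hcw := h.continuousOn_w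
  have hcq : ContinuousOn q (Icc 0 s) := by fun_prop
  have hne : ∀ r, y r ^ 2 + c ^ 2 ≠ 0 := fun r => by positivity
  have hcα : ContinuousOn α (Icc 0 s) := by
    refine ContinuousOn.div (by fun_prop) (by fun_prop) (fun r _ => hne r)
  have hsum : ∀ r ∈ Icc 0 s,
      y r ^ 2 + c ^ 2 = 2 * (y r * q r - x r * (w r + x r ^ 2 * y r / 2)) := by
    intro r hr
    have := h.energy hr
    simp only [hq]
    linarith
  have hdx : ∀ r ∈ Icc 0 s, HasDerivAt x (α r * x r + q r) r := by
    intro r hr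
    refine (h.hasDerivAt_x r hr).congr_deriv ?_
    have h1 := hne r
    simp only [hα, chazySpeed]
    field_simp
    rw [hsum r hr]
    simp only [hq]
    ring
  have hdq : ∀ r ∈ Icc 0 s, HasDerivAt q (α r * q r - x r) r := by
    intro r hr
    refine ((h.hasDerivAt_y r hr).add (((h.hasDerivAt_x r hr).pow 3).div_const 2)).congr_deriv ?_
    have h1 := hne r
    simp only [hα, chazySpeed]
    field_simp
    rw [hsum r hr]
    simp only [hq]
    push_cast
    ring
  have hdA : ∀ r ∈ Icc 0 s, HasDerivAt (fun r => x r * Real.cos r - q r * Real.sin r)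
      (α r * (x r * Real.cos r - q r * Real.sin r)) r := by
    intro r hr
    refine (((hdx r hr).mul (Real.hasDerivAt_cos r)).sub
      ((hdq r hr).mul (Real.hasDerivAt_sin r))).congr_deriv ?_
    ring
  obtain ⟨K, hK⟩ := isCompact_Icc.exists_bound_of_continuousOn hcα
  have hA : ∀ r ∈ Icc 0 s, x r * Real.cos r - q r * Real.sin r = 0 := by
    refine eq_zero_of_abs_deriv_le_mul_abs_self_of_eq_zero_right (K := K)
      (fun r hr => (hdA r hr).continuousAt.continuousWithinAt)
      (fun r hr => (hdA r (Ico_subset_Icc_self hr)).hasDerivWithinAt)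
      (by simp [h.x_zero]) ?_
    intro r hr
    rw [norm_mul]
    gcongr
    exact hK r (Ico_subset_Icc_self hr)
  set B : ℝ → ℝ := fun r => x r * Real.sin r + q r * Real.cos r with hB
  have hxB : ∀ r ∈ Icc 0 s, x r = B r * Real.sin r := by
    intro r hr
    simp only [hB]
    linear_combination Real.cos r * hA r hr - x r * Real.sin_sq_add_cos_sq r
  have hqB : ∀ r ∈ Icc 0 s, q r = B r * Real.cos r := by
    intro r hr
    simp only [hB]
    linear_combination - Real.sin r * hA r hr - q r * Real.sin_sq_add_cos_sq r
  refine ⟨B t, ?_, hxB t ht, hqB t ht⟩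
  by_contra! hBt
  have hB0 : 0 < B 0 := by simp [hB, hq, h.x_zero, h.y_zero, hc]
  have hcB : ContinuousOn B (Icc 0 s) := by fun_prop
  obtain ⟨r, hr, hBr⟩ := intermediate_value_Icc' ht.1 (hcB.mono (Icc_subset_Icc_right ht.2))
    ⟨hBt, hB0.le⟩
  have hr' : r ∈ Icc 0 s := ⟨hr.1, hr.2.trans ht.2⟩
  have hx0 : x r = 0 := by rw [hxB r hr', hBr, zero_mul]
  have hq0 : q r = 0 := by rw [hqB r hr', hBr, zero_mul]
  refine h.ne_zero hc hr' hx0 ?_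
  simpa [hq, hx0] using hq0

theorem x_nonneg (h : IsChazyArc c a s x y w) (hc : 0 < c) (hs : s ≤ Real.pi) {t : ℝ}
    (ht : t ∈ Icc 0 s) : 0 ≤ x t := by
  obtain ⟨B, hB, hx, -⟩ := h.exists_polar hc ht
  rw [hx]
  exact mul_nonneg hB.le (Real.sin_nonneg_of_nonneg_of_le_pi ht.1 (ht.2.trans hs))

theorem antitoneOn_w (h : IsChazyArc c a s x y w) (hc : 0 < c) (hs : s ≤ Real.pi) :
    AntitoneOn w (Icc 0 s) := by
  have := monotoneOn_Icc_of_hasDerivAt (fun t ht => (h.hasDerivAt_w t ht).neg) fun t ht => ?_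
  · intro t ht r hr htr
    simpa using this ht hr htr
  · have := mul_nonneg (chazySpeed_nonneg c (x t) (y t))
      (mul_nonneg (h.x_nonneg hc hs ht) (sq_nonneg (y t)))
    linarith

theorem end_x (h : IsChazyArc c a Real.pi x y w) (hc : 0 < c) : x Real.pi = 0 := by
  obtain ⟨B, -, hx, -⟩ := h.exists_polar hc (right_mem_Icc.2 Real.pi_nonneg)
  simpa using hx

theorem end_y (h : IsChazyArc c a Real.pi x y w) (hc : 0 < c) : y Real.pi = -c := by
  have hpi := right_mem_Icc.2 Real.pi_nonneg
  obtain ⟨B, hB, -, hy⟩ := h.exists_polar hc hpi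
  have he := h.energy hpi
  rw [h.end_x hc] at hy he
  have hneg : y Real.pi < 0 := by
    simp at hy
    linarith
  have : (y Real.pi - c) * (y Real.pi + c) = 0 := by linarith
  rcases mul_eq_zero.1 this with h' | h' <;> linarith

theorem x_pow_le (h : IsChazyArc c a s x y w) (hc : 0 < c) (hs : s ≤ Real.pi) {t : ℝ}
    (ht : t ∈ Icc 0 s) : ∃ X, x t ≤ X ∧ 0 ≤ X ∧ 4 * X ^ 6 ≤ 50 * (X * a) + 25 * c ^ 2 := by
  have h0s : 0 ≤ s := ht.1.trans ht.2
  obtain ⟨m, hm, hmax⟩ := isCompact_Icc.exists_isMaxOn (nonempty_Icc.2 h0s) h.continuousOn_x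
  refine ⟨x m, hmax ht, h.x_nonneg hc hs hm, ?_⟩
  have hym : 0 ≤ y m := by
    rcases hm.1.eq_or_lt with h0 | h0
    · rw [← h0, h.y_zero]; exact hc.le
    · by_contra! hneg
      have hd := h.hasDerivAt_x m hm
      have hlt : chazySpeed c (x m) (y m) * y m < 0 :=
        mul_neg_of_pos_of_neg (h.speed_pos hc hm) hneg
      have hev := (hasDerivWithinAt_iff_tendsto_slope' (by simp)).1 (hd.hasDerivWithinAt (s := Iio m))
      have hev' := (hev.eventually_lt_const hlt).and
        (Ioo_mem_nhdsLT h0)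
      obtain ⟨r, hr1, hr2⟩ := hev'.exists
      have hle : x r ≤ x m := hmax (show r ∈ Icc 0 s from ⟨hr2.1.le, hr2.2.le.trans hm.2⟩)
      rw [slope_def_field] at hr1
      have : 0 ≤ (x r - x m) / (r - m) :=
        div_nonneg_of_nonpos (by linarith) (by linarith [hr2.2])
      linarith
  have hL := monotoneOn_Icc_of_hasDerivAt (a := 0) (b := s)
    (f := fun r => -(w r + 2 / 5 * (x r ^ 2 * y r) + 2 / 25 * x r ^ 5))
    (f' := fun r => chazySpeed c (x r) (y r) * (c ^ 2 / 5 * x r))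
    (fun r hr => by
      refine ((((h.hasDerivAt_w r hr).add
        ((((h.hasDerivAt_x r hr).pow 2).mul (h.hasDerivAt_y r hr)).const_mul (2 / 5))).add
        (((h.hasDerivAt_x r hr).pow 5).const_mul (2 / 25))).neg).congr_deriv ?_
      push_cast
      simp only [Pi.pow_apply]
      linear_combination (1 / 5) * chazySpeed c (x r) (y r) * x r * h.energy hr)
    (fun r hr => mul_nonneg (chazySpeed_nonneg ..)
      (mul_nonneg (by positivity) (h.x_nonneg hc hs hr)))
  have hL' := hL (left_mem_Icc.2 h0s) hm hm.1
  simp only [h.x_zero, h.w_zero] at hL'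
  have hx := h.x_nonneg hc hs hm
  have he := h.energy hm
  have h1 : x m * (w m + 2 / 5 * (x m ^ 2 * y m) + 2 / 25 * x m ^ 5) ≤ x m * a :=
    mul_le_mul_of_nonneg_left (by linarith) hx
  have h2 : 0 ≤ x m ^ 3 * y m := by positivity
  nlinarith [sq_nonneg (y m)]

theorem w_le (h : IsChazyArc c a s x y w) (hc : 0 < c) (hs : s ≤ Real.pi) {t : ℝ}
    (ht : t ∈ Icc 0 s) : w t ≤ a := by
  have := h.antitoneOn_w hc hs (left_mem_Icc.2 (ht.1.trans ht.2)) ht ht.1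
  rwa [h.w_zero] at this

theorem exists_bound {c M : ℝ} (hc : 0 < c) (hM : 0 ≤ M) :
    ∃ ρ, 0 < ρ ∧ ∀ a s : ℝ, ∀ x y w : ℝ → ℝ, 0 ≤ a → a ≤ M → s ≤ Real.pi →
      IsChazyArc c a s x y w → ∀ t ∈ Icc 0 s, |x t| < ρ ∧ |y t| < ρ ∧ |w t| < ρ := by
  set C := 1 + 13 * M + 7 * c ^ 2 with hC
  set D := 1 + c ^ 2 + 2 * (C * M) with hD
  set Q := D + C ^ 3 / 2 with hQ
  set R := 2 * C * (C ^ 2 + Q ^ 2) with hR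
  have hC0 : 0 < C := by positivity
  have hD0 : 0 < D := by positivity
  have hQ0 : 0 < Q := by positivity
  have hR0 : 0 < R := by positivity
  refine ⟨C + D + M + R * Real.pi + 1, by positivity, fun a s x y w ha haM hs h => ?_⟩
  have hRpi : 0 < R * Real.pi := by positivity
  have hxC : ∀ t ∈ Icc 0 s, x t ≤ C := by
    intro t ht
    obtain ⟨X, hxX, hX0, hX⟩ := h.x_pow_le hc hs ht
    refine hxX.trans ?_
    by_contra! hlt
    have h1 : 1 ≤ X := by nlinarith [sq_nonneg c]
    have h2 : X ^ 2 ≤ X ^ 6 := pow_le_pow_right₀ h1 (by norm_num)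
    have h3 : X * a ≤ X * M := by gcongr
    have h4 : c ^ 2 * 1 ≤ c ^ 2 * X := by gcongr
    nlinarith
  have hx0 : ∀ t ∈ Icc 0 s, 0 ≤ x t := fun t ht => h.x_nonneg hc hs ht
  have hw : ∀ t ∈ Icc 0 s, w t ≤ M := fun t ht => (h.w_le hc hs ht).trans haM
  have hy : ∀ t ∈ Icc 0 s, |y t| ≤ D := by
    intro t ht
    have h1 : x t * w t ≤ C * M :=
      (mul_le_mul_of_nonneg_left (hw t ht) (hx0 t ht)).trans
        (mul_le_mul_of_nonneg_right (hxC t ht) hM)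
    have h2 := h.energy ht
    refine abs_le_of_sq_le_sq ?_ hD0.le
    have : 0 ≤ C * M := by positivity
    nlinarith [sq_nonneg c]
  have hw' : ∀ t ∈ Icc 0 s, -(R * Real.pi) ≤ w t := by
    intro t ht
    have hmono := monotoneOn_Icc_of_hasDerivAt (a := 0) (b := s)
      (fun r hr => (h.hasDerivAt_w r hr).add ((hasDerivAt_id r).const_mul R)) (fun r hr => ?_)
    · have := hmono (left_mem_Icc.2 (ht.1.trans ht.2)) ht ht.1
      simp only [Pi.add_apply, h.w_zero, id, mul_zero, add_zero] at this
      have : R * t ≤ R * Real.pi := by gcongr; exact ht.2.trans hs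
      linarith
    · have hx := hx0 r hr
      have hxc := hxC r hr
      have hq : |y r + x r ^ 3 / 2| ≤ Q := by
        refine (abs_add_le _ _).trans ?_
        have : |x r ^ 3 / 2| ≤ C ^ 3 / 2 := by
          rw [abs_of_nonneg (by positivity)]; gcongr
        linarith [hy r hr]
      have hq2 : (y r + x r ^ 3 / 2) ^ 2 ≤ Q ^ 2 := sq_le_sq' (abs_le.1 hq).1 (abs_le.1 hq).2
      have hS : chazySpeed c (x r) (y r) * (x r * y r ^ 2)
          ≤ 2 * x r * (x r ^ 2 + (y r + x r ^ 3 / 2) ^ 2) := by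
        unfold chazySpeed
        rw [div_mul_eq_mul_div, div_le_iff₀ (by positivity)]
        have : 0 ≤ x r * (x r ^ 2 + (y r + x r ^ 3 / 2) ^ 2) * c ^ 2 := by positivity
        linarith
      have hRle : 2 * x r * (x r ^ 2 + (y r + x r ^ 3 / 2) ^ 2) ≤ R := by
        rw [hR]; gcongr
      linarith
  intro t ht
  have h1 := hx0 t ht
  have h2 := hxC t ht
  have h3 := abs_le.1 (hy t ht)
  have h4 := hw t ht
  have h5 := hw' t ht
  refine ⟨abs_lt.2 ⟨?_, ?_⟩, abs_lt.2 ⟨?_, ?_⟩, abs_lt.2 ⟨?_, ?_⟩⟩ <;> linarith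

/-- The value of `w` after half a turn is bounded below independently of a large initial value. -/
theorem le_end_w (h : IsChazyArc c a Real.pi x y w) (hc : 0 < c) (ha : 0 < a)
    (hca : c ^ 2 + 2 * a < 4 * a ^ 2) : -(c ^ 2 / 2 + c / 2) ≤ w Real.pi := by
  have hpi := Real.pi_nonneg
  obtain ⟨τ, hτ, hyτ, hypos⟩ := exists_first_zero_s1 hpi h.continuousOn_y
    (by rw [h.y_zero]; exact hc) (by rw [h.end_y hc]; linarith)
  have hx0 : ∀ t ∈ Icc 0 Real.pi, 0 ≤ x t := fun t ht => h.x_nonneg hc le_rfl ht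
  have heτ := h.energy hτ
  have hxτ0 := hx0 τ hτ
  have hwτ : w τ < 0 := by
    by_contra! hw
    have : 0 ≤ x τ * w τ := by positivity
    rw [hyτ] at heτ
    nlinarith
  have hxτ : 1 ≤ x τ := by
    by_contra! hlt
    have hsub : Icc 0 τ ⊆ Icc 0 Real.pi := Icc_subset_Icc_right hτ.2
    have hxmono := monotoneOn_Icc_of_hasDerivAt (a := 0) (b := τ)
      (fun r hr => h.hasDerivAt_x r (hsub hr))
      (fun r hr => mul_nonneg (chazySpeed_nonneg ..) (hypos r hr))
    have hx1 : ∀ r ∈ Icc 0 τ, x r ≤ 1 := fun r hr =>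
      (hxmono hr (right_mem_Icc.2 hτ.1) hr.2).trans hlt.le
    have hy2 : ∀ r ∈ Icc 0 τ, y r ≤ 2 * a := by
      intro r hr
      have h1 : x r * w r ≤ 1 * a :=
        (mul_le_mul_of_nonneg_left (h.w_le hc le_rfl (hsub hr)) (hx0 r (hsub hr))).trans
          (mul_le_mul_of_nonneg_right (hx1 r hr) ha.le)
      have h2 := h.energy (hsub hr)
      nlinarith
    have hmono := monotoneOn_Icc_of_hasDerivAt (a := 0) (b := τ)
      (f := fun r => w r + a * x r ^ 2)
      (f' := fun r => chazySpeed c (x r) (y r) * (x r * y r * (2 * a - y r)))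
      (fun r hr => ((h.hasDerivAt_w r (hsub hr)).add
        (((h.hasDerivAt_x r (hsub hr)).pow 2).const_mul a)).congr_deriv (by push_cast; ring))
      (fun r hr => mul_nonneg (chazySpeed_nonneg ..) (mul_nonneg
        (mul_nonneg (hx0 r (hsub hr)) (hypos r hr)) (by linarith [hy2 r hr])))
    have := hmono (left_mem_Icc.2 hτ.1) (right_mem_Icc.2 hτ.1) hτ.1
    simp only [h.x_zero, h.w_zero] at this
    have hsq : a * x τ ^ 2 ≤ a * 1 := by
      gcongr
      nlinarith
    linarith
  have hsub : Icc τ Real.pi ⊆ Icc 0 Real.pi := Icc_subset_Icc_left hτ.1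
  have hw0 : ∀ r ∈ Icc τ Real.pi, w r < 0 := fun r hr =>
    (h.antitoneOn_w hc le_rfl hτ (hsub hr) hr.1).trans_lt hwτ
  have hy0 : ∀ r ∈ Icc τ Real.pi, y r ≤ 0 := by
    refine image_le_of_deriv_right_lt_deriv_boundary' (B := fun _ => 0) (B' := fun _ => 0)
      (h.continuousOn_y.mono hsub)
      (fun r hr => (h.hasDerivAt_y r (hsub (Ico_subset_Icc_self hr))).hasDerivWithinAt)
      hyτ.le continuousOn_const (fun r _ => hasDerivWithinAt_const ..) ?_
    intro r hr hyr
    have hr' := Ico_subset_Icc_self hr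
    refine mul_neg_of_pos_of_neg (h.speed_pos hc (hsub hr')) ?_
    rw [hyr]
    linarith [hw0 r hr']
  have hyc : ∀ r ∈ Icc τ Real.pi, -c ≤ y r := by
    intro r hr
    have h1 := h.energy (hsub hr)
    have h2 : x r * w r ≤ 0 := mul_nonpos_of_nonneg_of_nonpos (hx0 r (hsub hr)) (hw0 r hr).le
    nlinarith [hy0 r hr]
  obtain ⟨σ, hσ, hxσ⟩ := intermediate_value_Icc' hτ.2 (h.continuousOn_x.mono hsub)
    (show (1 : ℝ) ∈ Icc (x Real.pi) (x τ) by rw [h.end_x hc]; exact ⟨zero_le_one, hxτ⟩)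
  have hsubσ : Icc σ Real.pi ⊆ Icc τ Real.pi := Icc_subset_Icc_left hσ.1
  have hmono := monotoneOn_Icc_of_hasDerivAt (a := σ) (b := Real.pi)
    (f := fun r => w r - c / 2 * x r ^ 2)
    (f' := fun r => chazySpeed c (x r) (y r) * (x r * (-y r) * (y r + c)))
    (fun r hr => ((h.hasDerivAt_w r (hsub (hsubσ hr))).sub
      (((h.hasDerivAt_x r (hsub (hsubσ hr))).pow 2).const_mul (c / 2))).congr_deriv
        (by push_cast; ring))
    (fun r hr => mul_nonneg (chazySpeed_nonneg ..) (mul_nonneg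
      (mul_nonneg (hx0 r (hsub (hsubσ hr))) (by linarith [hy0 r (hsubσ hr)]))
      (by linarith [hyc r (hsubσ hr)])))
  have hend := hmono (left_mem_Icc.2 hσ.2) (right_mem_Icc.2 hσ.2) hσ.2
  have heσ := h.energy (hsub hσ)
  simp only [h.end_x hc, hxσ] at hend heσ
  nlinarith [sq_nonneg (y σ)]

end IsChazyArc

/-- A bounded globally Lipschitz vector field has a global integral curve through every point. -/
theorem LipschitzWith.exists_global_integralCurve {E : Type*} [NormedAddCommGroup E]
    [NormedSpace ℝ E] [CompleteSpace E] {F : E → E} {K L : ℝ≥0} (hF : LipschitzWith K F)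
    (hL : ∀ z, ‖F z‖ ≤ L) (z₀ : E) :
    ∃ Z : ℝ → E, Z 0 = z₀ ∧ ∀ t, HasDerivAt Z (F (Z t)) t := by
  have hloc : ∀ n : ℕ, ∃ Z : ℝ → E, Z 0 = z₀ ∧
      ∀ t ∈ Ioo (-((n : ℝ) + 1)) (n + 1), HasDerivAt Z (F (Z t)) t := by
    intro n
    have h0 : (0 : ℝ) ∈ Icc (-((n : ℝ) + 1)) (n + 1) := by
      constructor <;> linarith [(Nat.cast_nonneg n : (0 : ℝ) ≤ n)]
    have hPL : IsPicardLindelof (fun _ => F) (⟨0, h0⟩ : Icc (-((n : ℝ) + 1)) (n + 1)) z₀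
        (L * (n + 1)) 0 L K :=
      IsPicardLindelof.of_time_independent (fun z _ => hL z) hF.lipschitzOnWith (by simp)
    obtain ⟨Z, hZ0, hZ⟩ := hPL.exists_eq_forall_mem_Icc_hasDerivWithinAt₀
    exact ⟨Z, hZ0, fun t ht =>
      (hZ t (Ioo_subset_Icc_self ht)).hasDerivAt (Icc_mem_nhds ht.1 ht.2)⟩
  choose Z hZ0 hZ using hloc
  have heq : ∀ m n : ℕ, ∀ t : ℝ, |t| < m + 1 → |t| < n + 1 → Z m t = Z n t := by
    intro m n t hm hn
    set r : ℝ := min (m : ℝ) n + 1 with hr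
    have hr0 : 0 < r := by positivity
    have hrm : r ≤ m + 1 := by rw [hr]; gcongr; exact min_le_left _ _
    have hrn : r ≤ n + 1 := by rw [hr]; gcongr; exact min_le_right _ _
    have htr : |t| < r := by
      rw [hr, ← min_add_add_right]; exact lt_min hm hn
    refine ODE_solution_unique_of_mem_Ioo (v := fun _ => F) (s := fun _ => univ) (K := K)
      (a := -r) (b := r) (t₀ := 0) (fun _ _ => hF.lipschitzOnWith) ⟨by linarith, hr0⟩
      (fun u hu => ⟨hZ m u ⟨by linarith [hu.1], by linarith [hu.2]⟩, mem_univ _⟩)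
      (fun u hu => ⟨hZ n u ⟨by linarith [hu.1], by linarith [hu.2]⟩, mem_univ _⟩)
      (by rw [hZ0, hZ0]) (abs_lt.1 htr)
  have hceil : ∀ t : ℝ, |t| < ⌈|t|⌉₊ + 1 := fun t => (Nat.le_ceil _).trans_lt (lt_add_one _)
  refine ⟨fun t => Z ⌈|t|⌉₊ t, by simp [hZ0], fun t => ?_⟩
  refine (hZ ⌈|t|⌉₊ t (abs_lt.1 (hceil t))).congr_of_eventuallyEq ?_
  filter_upwards [continuous_abs.continuousAt.eventually_lt_const (hceil t)] with u hu
  exact heq _ _ u (hceil u) hu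

/-- The vector field whose integral curves through `(0, c, a)` are the arcs `IsChazyArc`. -/
noncomputable def chazyField (c : ℝ) (z : ℝ × ℝ × ℝ) : ℝ × ℝ × ℝ :=
  chazySpeed c z.1 z.2.1 • (z.2.1, z.2.2 - z.1 ^ 2 * z.2.1, -(z.1 * z.2.1 ^ 2))

theorem chazySpeed_neg (c x y : ℝ) : chazySpeed c (-x) (-y) = chazySpeed c x y := by
  unfold chazySpeed
  congr 1 <;> ring

theorem chazyField_neg (c : ℝ) (z : ℝ × ℝ × ℝ) : chazyField c (-z) = -chazyField c z := by
  simp only [chazyField, Prod.fst_neg, Prod.snd_neg, chazySpeed_neg, ← smul_neg, Prod.neg_mk]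
  congr 3 <;> ring

theorem contDiff_chazyField {c : ℝ} (hc : 0 < c) : ContDiff ℝ 1 (chazyField c) := by
  have hnum : ContDiff ℝ 1 fun z : ℝ × ℝ × ℝ => 2 * (z.1 ^ 2 + (z.2.1 + z.1 ^ 3 / 2) ^ 2) := by
    fun_prop
  have hden : ContDiff ℝ 1 fun z : ℝ × ℝ × ℝ => z.2.1 ^ 2 + c ^ 2 := by fun_prop
  have hV : ContDiff ℝ 1 fun z : ℝ × ℝ × ℝ =>
      (z.2.1, z.2.2 - z.1 ^ 2 * z.2.1, -(z.1 * z.2.1 ^ 2)) := by fun_prop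
  exact (hnum.div hden fun z => by positivity).smul hV

/-- Coordinatewise truncation to `[-ρ, ρ] ^ 3`. -/
def clamp (ρ : ℝ) (z : ℝ × ℝ × ℝ) : ℝ × ℝ × ℝ :=
  (max (-ρ) (min ρ z.1), max (-ρ) (min ρ z.2.1), max (-ρ) (min ρ z.2.2))

theorem lipschitzWith_clamp (ρ : ℝ) : LipschitzWith 1 (clamp ρ) := by
  have h1 : LipschitzWith 1 fun u : ℝ => max (-ρ) (min ρ u) :=
    (LipschitzWith.id.const_min ρ).const_max (-ρ)
  have hf : LipschitzWith 1 (Prod.fst : ℝ × ℝ × ℝ → ℝ) := LipschitzWith.prod_fst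
  have hs : LipschitzWith 1 (Prod.snd : ℝ × ℝ × ℝ → ℝ × ℝ) := LipschitzWith.prod_snd
  have hf' : LipschitzWith 1 (Prod.fst : ℝ × ℝ → ℝ) := LipschitzWith.prod_fst
  have hs' : LipschitzWith 1 (Prod.snd : ℝ × ℝ → ℝ) := LipschitzWith.prod_snd
  unfold clamp
  simpa [Function.comp_def] using (h1.comp hf).prodMk ((h1.comp (hf'.comp hs)).prodMk (h1.comp (hs'.comp hs)))

theorem clamp_neg {ρ : ℝ} (hρ : 0 ≤ ρ) (z : ℝ × ℝ × ℝ) : clamp ρ (-z) = -clamp ρ z := by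
  have h : ∀ u : ℝ, max (-ρ) (min ρ (-u)) = -max (-ρ) (min ρ u) := by
    intro u
    grind
  simp [clamp, h]

theorem norm_clamp_le {ρ : ℝ} (hρ : 0 ≤ ρ) (z : ℝ × ℝ × ℝ) : ‖clamp ρ z‖ ≤ ρ := by
  have h : ∀ u : ℝ, |max (-ρ) (min ρ u)| ≤ ρ := fun u =>
    abs_le.2 ⟨le_max_left _ _, max_le (by linarith) (min_le_left _ _)⟩
  simp [clamp, h]

theorem clamp_eq_self {ρ : ℝ} {z : ℝ × ℝ × ℝ} (hz : ‖z‖ ≤ ρ) : clamp ρ z = z := by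
  have h : ∀ u : ℝ, |u| ≤ ρ → max (-ρ) (min ρ u) = u := fun u hu => by
    rw [min_eq_right (abs_le.1 hu).2, max_eq_right (abs_le.1 hu).1]
  simp only [norm_prod_le_iff, Real.norm_eq_abs] at hz
  simp [clamp, h _ hz.1, h _ hz.2.1, h _ hz.2.2]

theorem exists_lipschitzWith_chazyField_comp_clamp {c ρ : ℝ} (hc : 0 < c) (hρ : 0 ≤ ρ) :
    ∃ K L : ℝ≥0, LipschitzWith K (chazyField c ∘ clamp ρ) ∧
      ∀ z, ‖(chazyField c ∘ clamp ρ) z‖ ≤ L := by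
  have hcomp := isCompact_closedBall (0 : ℝ × ℝ × ℝ) ρ
  have hmem : ∀ z, clamp ρ z ∈ Metric.closedBall (0 : ℝ × ℝ × ℝ) ρ := fun z =>
    mem_closedBall_zero_iff.2 (norm_clamp_le hρ z)
  have hsm := contDiff_chazyField hc
  obtain ⟨K, hK⟩ :=
    hsm.locallyLipschitz.locallyLipschitzOn.exists_lipschitzOnWith_of_compact hcomp
  obtain ⟨L, hL⟩ := hcomp.exists_bound_of_continuousOn hsm.continuous.continuousOn
  refine ⟨K, L.toNNReal, ?_, fun z => (hL _ (hmem z)).trans (Real.le_coe_toNNReal L)⟩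
  have := hK.comp ((lipschitzWith_clamp ρ).lipschitzOnWith (s := univ)) fun z _ => hmem z
  simpa [lipschitzOnWith_univ] using this

theorem HasDerivAt.components {Z : ℝ → ℝ × ℝ × ℝ} {v : ℝ × ℝ × ℝ} {t : ℝ}
    (h : HasDerivAt Z v t) :
    HasDerivAt (fun r => (Z r).1) v.1 t ∧ HasDerivAt (fun r => (Z r).2.1) v.2.1 t ∧
      HasDerivAt (fun r => (Z r).2.2) v.2.2 t :=
  have h₂ : HasDerivAt (fun r => (Z r).2) v.2 t :=
    (ContinuousLinearMap.snd ℝ ℝ (ℝ × ℝ)).hasFDerivAt.comp_hasDerivAt t h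
  ⟨(ContinuousLinearMap.fst ℝ ℝ (ℝ × ℝ)).hasFDerivAt.comp_hasDerivAt t h,
    (ContinuousLinearMap.fst ℝ ℝ ℝ).hasFDerivAt.comp_hasDerivAt t h₂,
    (ContinuousLinearMap.snd ℝ ℝ ℝ).hasFDerivAt.comp_hasDerivAt t h₂⟩

theorem isChazyArc_of_hasDerivAt {c a s : ℝ} {Z : ℝ → ℝ × ℝ × ℝ} (h0 : Z 0 = (0, c, a))
    (h : ∀ t ∈ Icc 0 s, HasDerivAt Z (chazyField c (Z t)) t) :
    IsChazyArc c a s (fun t => (Z t).1) (fun t => (Z t).2.1) (fun t => (Z t).2.2) where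
  x_zero := by simp [h0]
  y_zero := by simp [h0]
  w_zero := by simp [h0]
  hasDerivAt_x t ht := (h t ht).components.1
  hasDerivAt_y t ht := (h t ht).components.2.1
  hasDerivAt_w t ht := (h t ht).components.2.2

/-- A half turn of the flow maps some point `(0, c, a)` to its opposite. -/
theorem exists_antiperiodic_chazyField {c : ℝ} (hc : 0 < c) :
    ∃ (a : ℝ) (Z : ℝ → ℝ × ℝ × ℝ), Z 0 = (0, c, a) ∧
      (∀ t, HasDerivAt Z (chazyField c (Z t)) t) ∧ Function.Antiperiodic Z Real.pi ∧
      ∀ t, (Z t).2.1 ^ 2 = c ^ 2 + 2 * ((Z t).1 * (Z t).2.2) := by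
  have hpi := Real.pi_pos
  set M := c ^ 2 + c + 1 with hM
  have hM0 : 0 < M := by positivity
  obtain ⟨ρ₀, hρ₀, hbound⟩ := IsChazyArc.exists_bound hc hM0.le
  set ρ := ρ₀ + c + M with hρ
  have hρ0 : 0 < ρ := by positivity
  obtain ⟨K, L, hK, hL⟩ := exists_lipschitzWith_chazyField_comp_clamp hc hρ0.le
  choose Z hZ0 hZ using fun a : ℝ => hK.exists_global_integralCurve hL (0, c, a)
  have hcont : ∀ a, Continuous (Z a) := fun a =>
    continuous_iff_continuousAt.2 fun t => (hZ a t).continuousAt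
  have hin : ∀ a ∈ Icc 0 M, ∀ s ≤ Real.pi, (∀ t ∈ Icc 0 s, ‖Z a t‖ ≤ ρ) →
      IsChazyArc c a s (fun t => (Z a t).1) (fun t => (Z a t).2.1) (fun t => (Z a t).2.2) := by
    intro a ha s hs hle
    refine isChazyArc_of_hasDerivAt (hZ0 a) fun t ht => ?_
    have := hZ a t
    rwa [Function.comp_apply, clamp_eq_self (hle t ht)] at this
  have hle : ∀ a ∈ Icc 0 M, ∀ t ∈ Icc 0 Real.pi, ‖Z a t‖ ≤ ρ := by
    intro a ha t ht
    by_contra! hlt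
    have hstart : 0 < ρ - ‖Z a 0‖ := by
      rw [hZ0, sub_pos]
      simp only [Prod.norm_def, Real.norm_eq_abs, abs_zero, abs_of_pos hc, abs_of_nonneg ha.1]
      refine max_lt hρ0 (max_lt ?_ ?_) <;> linarith [ha.2]
    obtain ⟨r, hr, hr0, hrpos⟩ := exists_first_zero_s1 (f := fun r => ρ - ‖Z a r‖) ht.1
      (by fun_prop) hstart (by linarith)
    have hrpi : r ≤ Real.pi := hr.2.trans ht.2
    have harc := hin a ha r hrpi fun u hu => by linarith [hrpos u hu]
    obtain ⟨h1, h2, h3⟩ := hbound a r _ _ _ ha.1 ha.2 hrpi harc r (right_mem_Icc.2 hr.1)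
    have : ‖Z a r‖ < ρ₀ := by
      simp only [Prod.norm_def, Real.norm_eq_abs]
      exact max_lt h1 (max_lt h2 h3)
    linarith
  have harc : ∀ a ∈ Icc 0 M, IsChazyArc c a Real.pi (fun t => (Z a t).1) (fun t => (Z a t).2.1)
      (fun t => (Z a t).2.2) := fun a ha => hin a ha _ le_rfl (hle a ha)
  have hlip : LipschitzWith (Real.exp (K * Real.pi)).toNNReal fun a => Z a Real.pi := by
    refine LipschitzWith.of_dist_le_mul fun a b => ?_
    have := dist_le_of_trajectories_ODE (v := fun _ => chazyField c ∘ clamp ρ) (fun _ => hK)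
      (hcont a).continuousOn (fun t _ => (hZ a t).hasDerivWithinAt)
      (hcont b).continuousOn (fun t _ => (hZ b t).hasDerivWithinAt)
      (show dist (Z a 0) (Z b 0) ≤ dist a b by simp [hZ0, Prod.dist_eq])
      Real.pi (right_mem_Icc.2 hpi.le)
    rw [Real.coe_toNNReal _ (Real.exp_pos _).le]
    rw [sub_zero] at this
    linarith
  have hcontP : Continuous fun a => (Z a Real.pi).2.2 + a :=
    (continuous_snd.comp (continuous_snd.comp hlip.continuous)).add continuous_id
  have h0M : (0 : ℝ) ∈ Icc 0 M := left_mem_Icc.2 hM0.le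
  have hMM : M ∈ Icc 0 M := right_mem_Icc.2 hM0.le
  obtain ⟨a, ha, hroot⟩ := intermediate_value_Icc hM0.le hcontP.continuousOn
    (show (0 : ℝ) ∈ Icc ((Z 0 Real.pi).2.2 + 0) ((Z M Real.pi).2.2 + M) by
      constructor
      · simpa using (harc 0 h0M).w_le hc le_rfl (right_mem_Icc.2 hpi.le)
      · have := (harc M hMM).le_end_w hc hM0 (by nlinarith [sq_nonneg c])
        nlinarith [sq_nonneg c])
  have hhalf : Z a Real.pi = -Z a 0 := by
    rw [hZ0]
    refine Prod.ext ?_ (Prod.ext ?_ ?_)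
    · simpa using (harc a ha).end_x hc
    · simpa using (harc a ha).end_y hc
    · simp only [Prod.snd_neg]
      linarith
  have hanti : Function.Antiperiodic (Z a) Real.pi := by
    have hZ' : ∀ t, HasDerivAt (fun t => -Z a (t + Real.pi))
        ((chazyField c ∘ clamp ρ) (-Z a (t + Real.pi))) t := by
      intro t
      rw [Function.comp_apply, clamp_neg hρ0.le, chazyField_neg]
      exact ((hZ a (t + Real.pi)).comp_add_const t Real.pi).neg
    have := ODE_solution_unique_univ (v := fun _ => chazyField c ∘ clamp ρ) (s := fun _ => univ)
      (t₀ := 0) (fun _ => hK.lipschitzOnWith) (fun t => ⟨hZ' t, mem_univ _⟩)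
      (fun t => ⟨hZ a t, mem_univ _⟩) (by simp [hhalf])
    intro t
    rw [← congrFun this t, neg_neg]
  have hnorm : ∀ t, ‖Z a t‖ ≤ ρ := by
    intro t
    have hper : Function.Periodic (fun t => ‖Z a t‖) Real.pi := fun t => by
      simp only [hanti t, norm_neg]
    obtain ⟨r, hr, hrt⟩ := hper.exists_mem_Ico₀ hpi t
    rw [hrt]
    exact hle a ha r (Ico_subset_Icc_self hr)
  refine ⟨a, Z a, hZ0 a, fun t => ?_, hanti, fun t => ?_⟩
  · have := hZ a t
    rwa [Function.comp_apply, clamp_eq_self (hnorm t)] at this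
  · have hper : Function.Periodic
        (fun t => (Z a t).2.1 ^ 2 - 2 * ((Z a t).1 * (Z a t).2.2)) Real.pi := fun t => by
      simp only [hanti t, Prod.fst_neg, Prod.snd_neg]
      ring
    obtain ⟨r, hr, hrt⟩ := hper.exists_mem_Ico₀ hpi t
    have := (harc a ha).energy (Ico_subset_Icc_self hr)
    linarith

/-- Antiperiodic solutions of `x' = y`, `y' = w - x ^ 2 y`, `w' = -x y ^ 2`. -/
theorem exists_antiperiodic_chazySystem {c : ℝ} (hc : 0 < c) :
    ∃ (T : ℝ) (X : ℝ → ℝ × ℝ × ℝ), 0 < T ∧ Function.Antiperiodic X T ∧ (∃ t, (X t).2.1 ≠ 0) ∧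
      (∀ t, (X t).2.1 ^ 2 = c ^ 2 + 2 * ((X t).1 * (X t).2.2)) ∧
      ∀ t, HasDerivAt X
        ((X t).2.1, (X t).2.2 - (X t).1 ^ 2 * (X t).2.1, -((X t).1 * (X t).2.1 ^ 2)) t := by
  obtain ⟨a, Z, hZ0, hZ, hanti, henergy⟩ := exists_antiperiodic_chazyField hc
  have hpi := Real.pi_pos
  set g : ℝ → ℝ := fun t => chazySpeed c (Z t).1 (Z t).2.1 with hg
  have hZc : Continuous Z := continuous_iff_continuousAt.2 fun t => (hZ t).continuousAt
  have hgpos : ∀ t, 0 < g t := by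
    intro t
    refine chazySpeed_pos hc fun hx hy => ?_
    have := henergy t
    rw [hx, hy] at this
    nlinarith
  have hgc : Continuous g := by
    simp only [hg, chazySpeed]
    exact Continuous.div (by fun_prop) (by fun_prop) fun t => by positivity
  have hgper : Function.Periodic g Real.pi := fun t => by
    simp only [hg, hanti t, Prod.fst_neg, Prod.snd_neg, chazySpeed_neg]
  have hgint : ∀ u v, IntervalIntegrable g MeasureTheory.volume u v :=
    fun u v => hgc.intervalIntegrable u v
  set S : ℝ → ℝ := fun t => ∫ r in (0 : ℝ)..t, g r with hS
  have hSd : ∀ t, HasDerivAt S (g t) t := fun t => (hgc.integral_hasStrictDerivAt 0 t).hasDerivAt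
  have hSc : Continuous S := continuous_iff_continuousAt.2 fun t => (hSd t).continuousAt
  have hSmono : StrictMono S := strictMono_of_hasDerivAt_pos hSd hgpos
  have hSsurj : Function.Surjective S :=
    hSc.surjective (hgper.tendsto_atTop_intervalIntegral_of_pos' (hgint _ _) hgpos hpi)
      (hgper.tendsto_atBot_intervalIntegral_of_pos' (hgint _ _) hgpos hpi)
  have hSadd : ∀ t, S (t + Real.pi) = S t + S Real.pi := by
    intro t
    simp only [hS]
    rw [← intervalIntegral.integral_add_adjacent_intervals (hgint 0 t) (hgint t _),
      hgper.intervalIntegral_add_eq t 0, zero_add]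
  set e := hSmono.orderIsoOfSurjective S hSsurj with he
  have hSe : ∀ t, S (e.symm t) = t := fun t => e.apply_symm_apply t
  have hed : ∀ t, HasDerivAt e.symm (g (e.symm t))⁻¹ t := fun t =>
    (hSd (e.symm t)).of_local_left_inverse e.symm.continuous.continuousAt (hgpos _).ne'
      (Eventually.of_forall hSe)
  have headd : ∀ t, e.symm (t + S Real.pi) = e.symm t + Real.pi := by
    intro t
    apply hSmono.injective
    rw [hSe, hSadd, hSe]
  refine ⟨S Real.pi, fun t => Z (e.symm t), ?_, fun t => ?_, ⟨S 0, ?_⟩,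
    fun t => henergy _, fun t => ?_⟩
  · have := hSmono hpi
    simpa [hS] using this
  · simp only [headd, hanti _]
  · have : e.symm (S 0) = 0 := e.symm_apply_apply 0
    simp [this, hZ0, hc.ne']
  · refine ((hZ (e.symm t)).scomp t (hed t)).congr_deriv ?_
    rw [chazyField, inv_smul_smul₀ (hgpos _).ne']

/-- For `q = 2` and `k = 3`, the (polynomial) generalized Chazy equation
`x''' + x^2 x'' + 3 x x'^2 = 0` has, on each negative energy level
`H = x x'' - x'^2/2 + x^3 x' = -ω^2`, a nonconstant periodic solution. -/
theorem chazy_q2_periodic_orbits :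
    ∀ ω : ℝ, 0 < ω →
      ∃ (T : ℝ) (x : ℝ → ℝ),
        0 < T ∧
        Function.Periodic x T ∧
        (¬ ∃ c : ℝ, ∀ t : ℝ, x t = c) ∧
        ContDiff ℝ 3 x ∧
        (∀ t : ℝ,
          deriv (deriv (deriv x)) t + (x t) ^ 2 * deriv (deriv x) t
            + 3 * x t * (deriv x t) ^ 2 = 0) ∧
        (∀ t : ℝ, x t * deriv (deriv x) t - (deriv x t) ^ 2 / 2
            + (x t) ^ 3 * deriv x t = -ω ^ 2) := by
  intro ω hω
  obtain ⟨T, X, hT, hanti, ⟨t₀, ht₀⟩, henergy, hX⟩ :=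
    exists_antiperiodic_chazySystem (c := √2 * ω) (by positivity)
  have hXc : Continuous X := continuous_iff_continuousAt.2 fun t => (hX t).continuousAt
  set x : ℝ → ℝ := fun t => (X t).1 with hx
  set y : ℝ → ℝ := fun t => (X t).2.1 with hy
  set w : ℝ → ℝ := fun t => (X t).2.2 with hw
  have hxd : ∀ t, HasDerivAt x (y t) t := fun t => (hX t).components.1
  have hyd : ∀ t, HasDerivAt y (w t - x t ^ 2 * y t) t := fun t => (hX t).components.2.1
  have hwd : ∀ t, HasDerivAt w (-(x t * y t ^ 2)) t := fun t => (hX t).components.2.2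
  have hzd : ∀ t, HasDerivAt (fun t => w t - x t ^ 2 * y t)
      (-(3 * x t * y t ^ 2) - x t ^ 2 * (w t - x t ^ 2 * y t)) t := fun t =>
    ((hwd t).sub (((hxd t).pow 2).mul (hyd t))).congr_deriv (by
      simp only [Pi.pow_apply]
      push_cast
      ring)
  have h1 : deriv x = y := funext fun t => (hxd t).deriv
  have h2 : deriv y = fun t => w t - x t ^ 2 * y t := funext fun t => (hyd t).deriv
  have h3 : deriv (fun t => w t - x t ^ 2 * y t) =
      fun t => -(3 * x t * y t ^ 2) - x t ^ 2 * (w t - x t ^ 2 * y t) :=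
    funext fun t => (hzd t).deriv
  have hxc : Continuous x := by fun_prop
  have hyc : Continuous y := by fun_prop
  have hwc : Continuous w := by fun_prop
  refine ⟨2 * T, x, by positivity, ?_, ?_, ?_, ?_, ?_⟩
  · intro t
    simp only [hx]
    rw [hanti.periodic_two_mul t]
  · rintro ⟨k, hk⟩
    refine ht₀ ?_
    have : x = fun _ => k := funext hk
    have hy0 := (hxd t₀).deriv
    rw [this, deriv_const] at hy0
    exact hy0.symm
  · rw [show (3 : WithTop ℕ∞) = 1 + 1 + 1 by norm_num, contDiff_succ_iff_deriv, h1,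
      contDiff_succ_iff_deriv, h2, contDiff_one_iff_deriv, h3]
    exact ⟨fun t => (hxd t).differentiableAt, by simp, fun t => (hyd t).differentiableAt, by simp,
      fun t => (hzd t).differentiableAt, by fun_prop⟩
  · intro t
    rw [h1, h2, h3]
    ring
  · intro t
    rw [h1, h2]
    have h := henergy t
    rw [mul_pow, Real.sq_sqrt zero_le_two] at h
    linear_combination (-1 / 2) * h
end

section
/- For every real ω > 0 there exist T > 0 and a nonconstant T-periodic function x : ℝ → ℝ of class C³ such that x'''(t) + |x(t)|³·x''(t) + 4·x(t)·|x(t)|·x'(t)² = 0 for all t ∈ ℝ (note |x|³/x = x|x| extends continuously by 0 at x = 0) and x(t)·x''(t) − x'(t)²/2 + |x(t)|³·x(t)·x'(t) = −ω² for all t ∈ ℝ. (This expresses that for q = 3 and k = q + 1 = 4 the generalized Chazy differential equation has, on each negative energy level H = −ω², a periodic orbit; the union of these orbits over ω > 0 is an invariant topological cylinder foliated by periodic orbits.) -/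
namespace Chazy

open Set Topology

/-- A solution on `[0, s]`, starting from `(0, 1, c)`, of the Chazy equation written for `x ≥ 0` in
the variables `x`, `y = x'`, `g = x'' + x ^ 3 * x'`. -/
structure IsArc (c s : ℝ) (x y g : ℝ → ℝ) : Prop where
  x_zero : x 0 = 0
  y_zero : y 0 = 1
  g_zero : g 0 = c
  hasDeriv_x : ∀ t ∈ Icc 0 s, HasDerivWithinAt x (y t) (Icc 0 s) t
  hasDeriv_y : ∀ t ∈ Icc 0 s, HasDerivWithinAt y (g t - x t ^ 3 * y t) (Icc 0 s) t
  hasDeriv_g : ∀ t ∈ Icc 0 s, HasDerivWithinAt g (-(x t ^ 2 * y t ^ 2)) (Icc 0 s) t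
  nonneg : ∀ t ∈ Icc 0 s, 0 ≤ x t

lemma le_of_hasDerivWithinAt_nonpos {a b u v : ℝ} {f f' : ℝ → ℝ}
    (hf : ∀ t ∈ Icc a b, HasDerivWithinAt f (f' t) (Icc a b) t) (hau : a ≤ u) (huv : u ≤ v)
    (hvb : v ≤ b) (hf' : ∀ t ∈ Icc u v, f' t ≤ 0) : f v ≤ f u := by
  have hsub : Icc u v ⊆ Icc a b := Icc_subset_Icc hau hvb
  refine antitoneOn_of_hasDerivWithinAt_nonpos (convex_Icc u v) (f := f) (f' := f')
    (fun t ht => ((hf t (hsub ht)).mono hsub).continuousWithinAt)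
    (fun t ht => (hf t (hsub (interior_subset ht))).mono (interior_subset.trans hsub))
    (fun t ht => hf' t (interior_subset ht)) (left_mem_Icc.2 huv) (right_mem_Icc.2 huv) huv

lemma le_of_hasDerivWithinAt_nonneg {a b u v : ℝ} {f f' : ℝ → ℝ}
    (hf : ∀ t ∈ Icc a b, HasDerivWithinAt f (f' t) (Icc a b) t) (hau : a ≤ u) (huv : u ≤ v)
    (hvb : v ≤ b) (hf' : ∀ t ∈ Icc u v, 0 ≤ f' t) : f u ≤ f v := by
  have := le_of_hasDerivWithinAt_nonpos (f := fun t => -f t) (f' := fun t => -f' t)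
    (fun t ht => (hf t ht).neg) hau huv hvb (fun t ht => by linarith [hf' t ht])
  linarith

/-- A differentiable function that starts nonpositive stays so if its derivative is negative at
each of its zeros. -/
lemma nonpos_of_deriv_neg_of_eq_zero {a b u v : ℝ} {f f' : ℝ → ℝ}
    (hf : ∀ t ∈ Icc a b, HasDerivWithinAt f (f' t) (Icc a b) t) (hau : a ≤ u)
    (hvb : v ≤ b) (hu : f u ≤ 0) (hf' : ∀ t ∈ Ico u v, f t = 0 → f' t < 0) :
    ∀ t ∈ Icc u v, f t ≤ 0 := by
  have hsub : Icc u v ⊆ Icc a b := Icc_subset_Icc hau hvb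
  refine image_le_of_deriv_right_lt_deriv_boundary' (B := fun _ => 0) (B' := fun _ => 0)
    (f' := f') (fun t ht => ((hf t (hsub ht)).mono hsub).continuousWithinAt) ?_ hu
    continuousOn_const (fun t _ => hasDerivWithinAt_const ..) hf'
  intro t ht
  exact ((hf t (hsub (Ico_subset_Icc_self ht))).mono hsub).mono_of_mem_nhdsWithin
    (Icc_mem_nhdsGE_of_mem ht)

namespace IsArc

variable {c s : ℝ} {x y g : ℝ → ℝ}

lemma continuousOn_x (h : IsArc c s x y g) : ContinuousOn x (Icc 0 s) :=
  fun t ht => (h.hasDeriv_x t ht).continuousWithinAt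

lemma continuousOn_y (h : IsArc c s x y g) : ContinuousOn y (Icc 0 s) :=
  fun t ht => (h.hasDeriv_y t ht).continuousWithinAt

lemma continuousOn_g (h : IsArc c s x y g) : ContinuousOn g (Icc 0 s) :=
  fun t ht => (h.hasDeriv_g t ht).continuousWithinAt

lemma energy (h : IsArc c s x y g) {t : ℝ} (ht : t ∈ Icc 0 s) :
    y t ^ 2 = 1 + 2 * x t * g t := by
  have key : ∀ r ∈ Icc 0 s, HasDerivWithinAt (fun r => y r ^ 2 - 2 * x r * g r) 0 (Icc 0 s) r := by
    intro r hr
    refine (((h.hasDeriv_y r hr).pow 2).sub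
      (((h.hasDeriv_x r hr).const_mul 2).mul (h.hasDeriv_g r hr))).congr_deriv ?_
    push_cast
    ring
  have h1 := le_of_hasDerivWithinAt_nonpos key le_rfl ht.1 ht.2 (fun _ _ => le_rfl)
  have h2 := le_of_hasDerivWithinAt_nonneg key le_rfl ht.1 ht.2 (fun _ _ => le_rfl)
  simp only [h.x_zero, h.y_zero] at h1 h2
  linarith

lemma g_antitone (h : IsArc c s x y g) {u v : ℝ} (hu : 0 ≤ u) (huv : u ≤ v) (hv : v ≤ s) :
    g v ≤ g u :=
  le_of_hasDerivWithinAt_nonpos h.hasDeriv_g hu huv hv fun t _ => by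
    have := mul_nonneg (sq_nonneg (x t)) (sq_nonneg (y t))
    linarith

lemma g_le (h : IsArc c s x y g) {t : ℝ} (ht : t ∈ Icc 0 s) : g t ≤ c :=
  h.g_zero ▸ h.g_antitone le_rfl ht.1 ht.2

lemma y_pos_of_ne_zero (h : IsArc c s x y g) {t : ℝ} (ht : t ∈ Icc 0 s)
    (hy : ∀ r ∈ Icc 0 t, y r ≠ 0) : 0 < y t := by
  by_contra! hneg
  obtain ⟨r, hr, hr0⟩ := intermediate_value_Icc' ht.1
    (h.continuousOn_y.mono (Icc_subset_Icc_right ht.2))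
    (show (0 : ℝ) ∈ Icc (y t) (y 0) from ⟨hneg, by rw [h.y_zero]; norm_num⟩)
  exact hy r hr hr0

lemma one_le_y (h : IsArc c s x y g) {t : ℝ} (ht : t ∈ Icc 0 s) (hg : 0 ≤ g t) : 1 ≤ y t := by
  have key : ∀ r ∈ Icc 0 t, 1 ≤ y r ^ 2 := fun r hr => by
    have hr' : r ∈ Icc 0 s := ⟨hr.1, hr.2.trans ht.2⟩
    have := mul_nonneg (h.nonneg r hr') (hg.trans (h.g_antitone hr.1 hr.2 ht.2))
    linarith [h.energy hr']
  have := h.y_pos_of_ne_zero ht (fun r hr h0 => by have := key r hr; norm_num [h0] at this)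
  nlinarith [key t (right_mem_Icc.2 ht.1)]

lemma sq_le_one_of_g_nonpos (h : IsArc c s x y g) {t : ℝ} (ht : t ∈ Icc 0 s) (hg : g t ≤ 0) :
    y t ^ 2 ≤ 1 := by
  have := mul_nonneg (h.nonneg t ht) (neg_nonneg.2 hg)
  linarith [h.energy ht]

lemma neg_one_le_y (h : IsArc c s x y g) {t : ℝ} (ht : t ∈ Icc 0 s) : -1 ≤ y t := by
  rcases le_total 0 (g t) with hg | hg
  · linarith [h.one_le_y ht hg]
  · nlinarith [h.sq_le_one_of_g_nonpos ht hg]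

lemma hasDeriv_w (h : IsArc c s x y g) : ∀ t ∈ Icc 0 s,
    HasDerivWithinAt (fun r => y r + x r ^ 4 / 4) (g t) (Icc 0 s) t := fun t ht => by
  refine ((h.hasDeriv_y t ht).add (((h.hasDeriv_x t ht).pow 4).div_const 4)).congr_deriv ?_
  push_cast
  ring

lemma hasDeriv_g_add_cube (h : IsArc c s x y g) (k : ℝ) : ∀ t ∈ Icc 0 s,
    HasDerivWithinAt (fun r => g r + k * x r ^ 3) (x t ^ 2 * y t * (3 * k - y t)) (Icc 0 s) t :=
  fun t ht => by
  refine ((h.hasDeriv_g t ht).add (((h.hasDeriv_x t ht).pow 3).const_mul k)).congr_deriv ?_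
  push_cast
  ring

lemma x_le_three (h : IsArc c s x y g) (hc : c ≤ 9) {t : ℝ} (ht : t ∈ Icc 0 s) (hg : 0 ≤ g t) :
    x t ≤ 3 := by
  have := le_of_hasDerivWithinAt_nonpos (h.hasDeriv_g_add_cube (1 / 3)) le_rfl ht.1 ht.2
    (fun r hr => by
      have := h.one_le_y ⟨hr.1, hr.2.trans ht.2⟩ (hg.trans (h.g_antitone hr.1 hr.2 ht.2))
      exact mul_nonpos_of_nonneg_of_nonpos (by positivity) (by linarith))
  simp only [h.x_zero, h.g_zero] at this
  by_contra! h3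
  have : (3 : ℝ) ^ 3 < x t ^ 3 := by gcongr
  linarith

lemma exists_g_eq_zero (h : IsArc c s x y g) (hc : 0 ≤ c) {t : ℝ} (ht : t ∈ Icc 0 s)
    (hg : g t ≤ 0) : ∃ r ∈ Icc 0 t, g r = 0 :=
  intermediate_value_Icc' ht.1 (h.continuousOn_g.mono (Icc_subset_Icc_right ht.2))
    ⟨hg, h.g_zero ▸ hc⟩

lemma w_le (h : IsArc c s x y g) (hc : c ∈ Icc 0 9) {t : ℝ} (ht : t ∈ Icc 0 s) (hg : g t ≤ 0) :
    y t + x t ^ 4 / 4 ≤ 1 + 81 / 4 := by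
  obtain ⟨r, hr, hr0⟩ := h.exists_g_eq_zero hc.1 ht hg
  have hr' : r ∈ Icc 0 s := ⟨hr.1, hr.2.trans ht.2⟩
  have h1 := le_of_hasDerivWithinAt_nonpos h.hasDeriv_w hr.1 hr.2 ht.2
    (fun u hu => hr0 ▸ h.g_antitone hr.1 hu.1 (hu.2.trans ht.2))
  have h2 := h.x_le_three hc.2 hr' hr0.ge
  have h3 : x r ^ 4 ≤ 3 ^ 4 := by
    have := h.nonneg r hr'
    gcongr
  have := h.sq_le_one_of_g_nonpos hr' hr0.le
  nlinarith

lemma x_le (h : IsArc c s x y g) (hc : c ∈ Icc 0 9) {t : ℝ} (ht : t ∈ Icc 0 s) : x t ≤ 4 := by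
  rcases le_total 0 (g t) with hg | hg
  · linarith [h.x_le_three hc.2 ht hg]
  · have h1 := h.w_le hc ht hg
    have h2 := h.neg_one_le_y ht
    by_contra! h4
    have : (4 : ℝ) ^ 4 < x t ^ 4 := by gcongr
    linarith

lemma y_le (h : IsArc c s x y g) (hc : c ∈ Icc 0 9) {t : ℝ} (ht : t ∈ Icc 0 s) : y t ≤ 8 := by
  rcases le_total 0 (g t) with hg | hg
  · have := h.energy ht
    nlinarith [h.x_le_three hc.2 ht hg, h.g_le ht, hc.2, h.nonneg t ht]
  · nlinarith [h.sq_le_one_of_g_nonpos ht hg]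

lemma le_g (h : IsArc c s x y g) (hc : c ∈ Icc 0 9) {t : ℝ} (ht : t ∈ Icc 0 s) :
    -(1024 * t) ≤ g t := by
  have := le_of_hasDerivWithinAt_nonneg (f := fun r => g r + 1024 * r)
    (fun r hr => (h.hasDeriv_g r hr).add ((hasDerivWithinAt_id r _).const_mul 1024))
    le_rfl ht.1 ht.2 (fun r hr => by
      have hr' : r ∈ Icc 0 s := ⟨hr.1, hr.2.trans ht.2⟩
      have h1 : x r ^ 2 ≤ 4 ^ 2 := by
        have := h.nonneg r hr'
        have := h.x_le hc hr'
        gcongr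
      have h2 : y r ^ 2 ≤ 8 ^ 2 := by
        nlinarith [h.y_le hc hr', h.neg_one_le_y hr']
      have : x r ^ 2 * y r ^ 2 ≤ 4 ^ 2 * 8 ^ 2 := by gcongr
      linarith)
  simp only [h.g_zero] at this
  linarith [hc.1]

lemma lt_eight (h : IsArc c s x y g) (hc : c ∈ Icc 0 9) {t : ℝ} (ht : t ∈ Icc 0 s)
    (hg : -(1 / 16) ≤ g t) : t < 8 := by
  have hy2 : ∀ r ∈ Icc 0 t, 1 / 2 ≤ y r ^ 2 := fun r hr => by
    have hr' : r ∈ Icc 0 s := ⟨hr.1, hr.2.trans ht.2⟩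
    have := h.g_antitone hr.1 hr.2 ht.2
    nlinarith [h.energy hr', h.nonneg r hr', h.x_le hc hr']
  have hy : ∀ r ∈ Icc 0 t, 1 / 2 ≤ y r := fun r hr => by
    have := h.y_pos_of_ne_zero (t := r) ⟨hr.1, hr.2.trans ht.2⟩ (fun u hu h0 => by
      have := hy2 u ⟨hu.1, hu.2.trans hr.2⟩
      norm_num [h0] at this)
    nlinarith [hy2 r hr]
  have hx : ∀ r ∈ Icc 0 t, r / 2 ≤ x r := fun r hr => by
    have := le_of_hasDerivWithinAt_nonneg (f := fun r => x r - r / 2)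
      (fun r hr => (h.hasDeriv_x r hr).sub ((hasDerivWithinAt_id r _).div_const 2))
      le_rfl hr.1 (hr.2.trans ht.2)
      (fun u hu => by linarith [hy u ⟨hu.1, hu.2.trans hr.2⟩])
    simp only [h.x_zero] at this
    linarith
  have := le_of_hasDerivWithinAt_nonpos (f := fun r => g r + r ^ 3 / 24)
    (fun r hr => (h.hasDeriv_g r hr).add (((hasDerivWithinAt_id r _).pow 3).div_const 24))
    le_rfl ht.1 ht.2 (fun r hr => by
      have h1 : (r / 2) ^ 2 ≤ x r ^ 2 := by
        have := hr.1
        have := hx r hr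
        gcongr
      have h2 := hy2 r hr
      have : (r / 2) ^ 2 * (1 / 2) ≤ x r ^ 2 * y r ^ 2 := by gcongr
      simp only [id]
      push_cast
      linarith)
  simp only [h.g_zero] at this
  by_contra! h8
  have : (8 : ℝ) ^ 3 ≤ t ^ 3 := by gcongr
  linarith [hc.2]

lemma lt_time_bound (h : IsArc c s x y g) (hc : c ∈ Icc 0 9) (hs : 0 ≤ s) : s < 1200 := by
  by_contra! hbig
  have h8 : ∀ t ∈ Icc 8 s, g t ≤ -(1 / 16) := fun t ht => by
    by_contra! hg
    exact absurd (h.lt_eight hc ⟨by linarith [ht.1], ht.2⟩ hg.le) (not_lt.2 ht.1)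
  have := le_of_hasDerivWithinAt_nonpos (f := fun r => (y r + x r ^ 4 / 4) + r / 16)
    (fun r hr => (h.hasDeriv_w r hr).add ((hasDerivWithinAt_id r _).div_const 16))
    (by norm_num : (0 : ℝ) ≤ 8) (by linarith) le_rfl (fun r hr => by linarith [h8 r hr])
  have h1 := h.w_le hc (t := 8) ⟨by norm_num, by linarith⟩ (by linarith [h8 8 ⟨le_rfl, by linarith⟩])
  have h2 := h.neg_one_le_y (right_mem_Icc.2 hs)
  have : 0 ≤ x s ^ 4 := by positivity
  linarith

lemma neg_one_le_barrier (h : IsArc c s x y g) (hx : ∀ t ∈ Ioo 0 s, 0 < x t) {t : ℝ}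
    (ht : t ∈ Icc 0 s) : -1 ≤ y t * (1 + x t ^ 4) := by
  have := nonpos_of_deriv_neg_of_eq_zero (f := fun r => -1 - y r * (1 + x r ^ 4))
    (fun r hr => ((h.hasDeriv_y r hr).mul (((h.hasDeriv_x r hr).pow 4).const_add 1)).const_sub (-1))
    le_rfl le_rfl (by norm_num [h.x_zero, h.y_zero]) (fun r hr h0 => by
      have hr' := Ico_subset_Icc_self hr
      have hxr : 0 < x r := by
        refine hx r ⟨lt_of_le_of_ne hr.1 ?_, hr.2⟩
        rintro rfl
        norm_num [h.x_zero, h.y_zero] at h0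
      have hy : y r = -1 / (1 + x r ^ 4) := by
        field_simp
        linarith
      have hg : g r = (y r ^ 2 - 1) / (2 * x r) := by
        have := h.energy hr'
        field_simp
        linarith
      rw [hg, hy, Pi.pow_apply]
      push_cast
      have : 0 < x r ^ 3 * (1 / 2 * x r ^ 4 + 4 / (1 + x r ^ 4)) / (1 + x r ^ 4) := by positivity
      refine lt_of_eq_of_lt ?_ (neg_neg_of_pos this)
      field_simp
      ring) t ht
  linarith

lemma neg_nine_le_g (h : IsArc 9 s x y g) (hs : 0 < s) (hxs : x s = 0)
    (hx : ∀ t ∈ Ioo 0 s, 0 < x t) : -9 ≤ g s := by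
  by_contra! hgs
  have hss : s ∈ Icc 0 s := right_mem_Icc.2 hs.le
  have hc : (9 : ℝ) ∈ Icc 0 9 := by norm_num
  obtain ⟨r, hr, hr0⟩ := h.exists_g_eq_zero hc.1 hss (by linarith)
  have hxr : 1 ≤ x r := by
    have := le_of_hasDerivWithinAt_nonneg (h.hasDeriv_g_add_cube (8 / 3)) le_rfl hr.1 hr.2
      (fun u hu => by
        have hu' : u ∈ Icc 0 s := ⟨hu.1, hu.2.trans hr.2⟩
        have := h.one_le_y hu' (hr0 ▸ h.g_antitone hu.1 hu.2 hr.2)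
        have := h.y_le hc hu'
        exact mul_nonneg (by positivity) (by linarith))
    simp only [h.x_zero, h.g_zero, hr0] at this
    by_contra! h1
    have : x r ^ 3 ≤ 1 := pow_le_one₀ (h.nonneg r hr) h1.le
    linarith
  obtain ⟨m, hm, hmax⟩ := isCompact_Icc.exists_isMaxOn ⟨s, hss⟩ h.continuousOn_x
  have hxm : 1 ≤ x m := hxr.trans (hmax hr)
  have hm0 : 0 < m := lt_of_le_of_ne hm.1 (by rintro rfl; norm_num [h.x_zero] at hxm)
  have hms : m < s := lt_of_le_of_ne hm.2 (by rintro rfl; norm_num [hxs] at hxm)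
  have hnhds : Icc 0 s ∈ 𝓝 m := Icc_mem_nhds hm0 hms
  have hym : y m = 0 :=
    (hmax.isLocalMax hnhds).hasDerivAt_eq_zero ((h.hasDeriv_x m hm).hasDerivAt hnhds)
  have hneg : ∀ t ∈ Icc m s, y t ≤ 0 :=
    nonpos_of_deriv_neg_of_eq_zero h.hasDeriv_y hm.1 le_rfl hym.le (fun t ht h0 => by
      have ht' : t ∈ Ioo 0 s := ⟨hm0.trans_le ht.1, ht.2⟩
      have := h.energy (Ioo_subset_Icc_self ht')
      rw [h0] at this ⊢
      nlinarith [hx t ht'])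
  have hgm : -(1 / 2) ≤ g m := by
    have := h.energy hm
    rw [hym] at this
    nlinarith
  have := le_of_hasDerivWithinAt_nonneg (f := fun t => g t + 5 / 2 * (1 + x t)⁻¹)
    (fun t ht => (h.hasDeriv_g t ht).add
      (HasDerivWithinAt.const_mul (5 / 2) (((h.hasDeriv_x t ht).const_add 1).inv
        (by linarith [h.nonneg t ht])))) hm.1 hms.le le_rfl (fun t ht => by
      have ht' : t ∈ Icc 0 s := ⟨hm.1.trans ht.1, ht.2⟩
      have hb := h.neg_one_le_barrier hx ht'
      have hy := hneg t ht
      have hx0 := h.nonneg t ht'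
      have hpoly : x t ^ 2 * (1 + x t) ^ 2 ≤ 5 / 2 * (1 + x t ^ 4) := by
        nlinarith [sq_nonneg (x t ^ 2 - x t - 1 / 2), sq_nonneg (x t - 1), sq_nonneg (x t ^ 2 - 1)]
      have h1 : x t ^ 2 * (1 + x t) ^ 2 * -y t ≤ 5 / 2 := by
        nlinarith
      have h2 : -(x t ^ 2 * y t ^ 2) + 5 / 2 * (-y t / (1 + x t) ^ 2)
          = -y t * (5 / 2 - x t ^ 2 * (1 + x t) ^ 2 * -y t) / (1 + x t) ^ 2 := by
        field_simp
        ring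
      rw [h2]
      exact div_nonneg (mul_nonneg (by linarith) (by linarith)) (by positivity))
  simp only [hxs] at this
  have : 0 ≤ (1 + x m)⁻¹ := by positivity
  linarith

end IsArc

/-- The polynomial vector field governing `(x, x', x'' + x ^ 3 * x')` for `x ≥ 0`. -/
def field (v : ℝ × ℝ × ℝ) : ℝ × ℝ × ℝ :=
  (v.2.1, v.2.2 - v.1 ^ 3 * v.2.1, -(v.1 ^ 2 * v.2.1 ^ 2))

/-- The projection onto the cube `[-R, R] ^ 3`. -/
def clamp (R : ℝ) (v : ℝ × ℝ × ℝ) : ℝ × ℝ × ℝ :=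
  (max (-R) (min R v.1), max (-R) (min R v.2.1), max (-R) (min R v.2.2))

lemma contDiff_field : ContDiff ℝ 1 field := by
  unfold field
  fun_prop

lemma lipschitzWith_clamp (R : ℝ) : LipschitzWith 1 (clamp R) := by
  have key : LipschitzWith 1 fun r : ℝ => max (-R) (min R r) :=
    (LipschitzWith.id.const_min R).const_max (-R)
  have h1 := key.comp (LipschitzWith.prod_fst (α := ℝ) (β := ℝ × ℝ))
  have h2 := key.comp (LipschitzWith.prod_fst.comp (LipschitzWith.prod_snd (α := ℝ) (β := ℝ × ℝ)))
  have h3 := key.comp (LipschitzWith.prod_snd.comp (LipschitzWith.prod_snd (α := ℝ) (β := ℝ × ℝ)))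
  exact (h1.prodMk (h2.prodMk h3)).weaken (by simp)

lemma clamp_mem_closedBall {R : ℝ} (hR : 0 ≤ R) (v : ℝ × ℝ × ℝ) :
    clamp R v ∈ Metric.closedBall 0 R := by
  have key (r : ℝ) : |max (-R) (min R r)| ≤ R :=
    abs_le.2 ⟨le_max_left .., max_le (by linarith) (min_le_left ..)⟩
  simp [clamp, Prod.norm_def, key]

lemma clamp_eq_self {R : ℝ} {v : ℝ × ℝ × ℝ} (h1 : |v.1| ≤ R) (h2 : |v.2.1| ≤ R)
    (h3 : |v.2.2| ≤ R) : clamp R v = v := by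
  rw [abs_le] at h1 h2 h3
  simp [clamp, h1, h2, h3]

/-- A bounded locally Lipschitz vector field has a flow over every bounded time interval. -/
lemma exists_flow_of_locallyLipschitz {E : Type*} [NormedAddCommGroup E] [NormedSpace ℝ E]
    [ProperSpace E] {f : E → E} (hf : LocallyLipschitz f) {L : ℝ} (hL : ∀ v, ‖f v‖ ≤ L)
    {T r : ℝ} (hT : 0 ≤ T) (hr : 0 ≤ r) :
    ∃ α : E × ℝ → E, (∀ v ∈ Metric.closedBall 0 r, α (v, 0) = v ∧
      ∀ t ∈ Icc 0 T, HasDerivWithinAt (α ⟨v, ·⟩) (f (α (v, t))) (Icc 0 T) t) ∧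
      ContinuousOn α (Metric.closedBall 0 r ×ˢ Icc 0 T) := by
  have hL0 : 0 ≤ L := (norm_nonneg _).trans (hL 0)
  obtain ⟨K, hK⟩ := hf.locallyLipschitzOn.exists_lipschitzOnWith_of_compact
    (isCompact_closedBall (0 : E) (L * T + r))
  lift L to NNReal using hL0
  lift T to NNReal using hT
  lift r to NNReal using hr
  have hpl : IsPicardLindelof (fun _ => f) (⟨0, le_rfl, T.2⟩ : Icc (0 : ℝ) T) 0
      (L * T + r) r L K :=
    .of_time_independent (fun v _ => hL v) (by simpa using hK) (by simp)
  exact hpl.exists_forall_mem_closedBall_eq_hasDerivWithinAt_continuousOn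

lemma exists_truncated_flow {R : ℝ} (hR : 0 ≤ R) :
    ∃ γ : ℝ → ℝ → ℝ × ℝ × ℝ, Continuous (Function.uncurry γ) ∧
      ∀ c ∈ Icc (0 : ℝ) 9, γ c 0 = (0, 1, c) ∧ ∀ t ∈ Icc (0 : ℝ) 1200,
        HasDerivWithinAt (γ c) (field (clamp R (γ c t))) (Icc 0 1200) t := by
  obtain ⟨L, hL⟩ := (isCompact_closedBall (0 : ℝ × ℝ × ℝ) R).exists_bound_of_continuousOn
    contDiff_field.continuous.continuousOn
  obtain ⟨α, hα, hcont⟩ := exists_flow_of_locallyLipschitz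
    (f := fun v => field (clamp R v))
    (contDiff_field.locallyLipschitz.comp (lipschitzWith_clamp R).locallyLipschitz)
    (fun v => hL _ (clamp_mem_closedBall hR v)) (T := 1200) (r := 9) (by norm_num) (by norm_num)
  have h9 : (0 : ℝ) ≤ 9 := by norm_num
  have h12 : (0 : ℝ) ≤ 1200 := by norm_num
  have hball : ∀ c ∈ Icc (0 : ℝ) 9, ((0, 1, c) : ℝ × ℝ × ℝ) ∈ Metric.closedBall 0 9 := by
    intro c hc
    simpa [Prod.norm_def, abs_of_nonneg hc.1] using hc.2
  refine ⟨fun c t => α ((0, 1, (projIcc 0 9 h9 c : ℝ)), (projIcc 0 1200 h12 t : ℝ)), ?_, ?_⟩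
  · refine hcont.comp_continuous (f := fun p : ℝ × ℝ =>
      (((0, 1, (projIcc 0 9 h9 p.1 : ℝ)) : ℝ × ℝ × ℝ), (projIcc 0 1200 h12 p.2 : ℝ))) ?_ ?_
    · have := continuous_projIcc (h := h9)
      have := continuous_projIcc (h := h12)
      fun_prop
    · exact fun p => ⟨hball _ (Subtype.coe_prop _), Subtype.coe_prop _⟩
  · intro c hc
    have hproj (t : ℝ) (ht : t ∈ Icc (0 : ℝ) 1200) : (projIcc 0 1200 h12 t : ℝ) = t := by
      rw [projIcc_of_mem h12 ht]
    simp only [projIcc_of_mem h9 hc]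
    refine ⟨by rw [hproj 0 ⟨le_rfl, h12⟩, (hα _ (hball c hc)).1], fun t ht => ?_⟩
    rw [hproj t ht]
    exact ((hα _ (hball c hc)).2 t ht).congr (fun u hu => by rw [hproj u hu]) (by rw [hproj t ht])

lemma isArc_of_truncated {R c s : ℝ} {γ : ℝ → ℝ × ℝ × ℝ} (h0 : γ 0 = (0, 1, c))
    (hγ : ∀ t ∈ Icc (0 : ℝ) 1200,
      HasDerivWithinAt γ (field (clamp R (γ t))) (Icc 0 1200) t) (hs : s ≤ 1200)
    (hbox : ∀ t ∈ Icc 0 s, 0 ≤ (γ t).1 ∧ |(γ t).1| ≤ R ∧ |(γ t).2.1| ≤ R ∧ |(γ t).2.2| ≤ R) :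
    IsArc c s (fun t => (γ t).1) (fun t => (γ t).2.1) (fun t => (γ t).2.2) := by
  have hd : ∀ t ∈ Icc 0 s, HasDerivWithinAt γ (field (γ t)) (Icc 0 s) t := fun t ht => by
    obtain ⟨-, h1, h2, h3⟩ := hbox t ht
    have := (hγ t ⟨ht.1, ht.2.trans hs⟩).mono (Icc_subset_Icc_right hs)
    rwa [clamp_eq_self h1 h2 h3] at this
  exact
    { x_zero := by simp [h0]
      y_zero := by simp [h0]
      g_zero := by simp [h0]
      hasDeriv_x := fun t ht => (hd t ht).fst
      hasDeriv_y := fun t ht => (hd t ht).snd.fst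
      hasDeriv_g := fun t ht => (hd t ht).snd.snd
      nonneg := fun t ht => (hbox t ht).1 }

lemma exists_isArc_of_truncated {R c : ℝ} (hR : 2000000 ≤ R) (hc : c ∈ Icc (0 : ℝ) 9)
    {γ : ℝ → ℝ × ℝ × ℝ} (hcont : Continuous γ) (h0 : γ 0 = (0, 1, c))
    (hγ : ∀ t ∈ Icc (0 : ℝ) 1200,
      HasDerivWithinAt γ (field (clamp R (γ t))) (Icc 0 1200) t) :
    ∃ s ∈ Ioc (0 : ℝ) 1200,
      IsArc c s (fun t => (γ t).1) (fun t => (γ t).2.1) (fun t => (γ t).2.2) ∧ (γ s).1 = 0 := by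
  by_contra! hno
  have hbdd : ∀ t ∈ Icc (0 : ℝ) 1200,
      IsArc c t (fun t => (γ t).1) (fun t => (γ t).2.1) (fun t => (γ t).2.2) →
      |(γ t).1| < R ∧ |(γ t).2.1| < R ∧ |(γ t).2.2| < R := fun t ht h => by
    have hmem : t ∈ Icc 0 t := right_mem_Icc.2 ht.1
    have h1 := h.nonneg t hmem
    have h2 := h.x_le hc hmem
    have h3 := h.neg_one_le_y hmem
    have h4 := h.y_le hc hmem
    have h5 := h.le_g hc hmem
    have h6 := h.g_le hmem
    simp only [abs_lt] at *
    exact ⟨⟨by linarith, by linarith⟩, ⟨by linarith, by linarith⟩,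
      by linarith [ht.2], by linarith [hc.2]⟩
  set S : Set ℝ := {t | ∀ θ ∈ Icc (0 : ℝ) 1, 0 ≤ (γ (θ * t)).1 ∧ |(γ (θ * t)).1| ≤ R ∧
    |(γ (θ * t)).2.1| ≤ R ∧ |(γ (θ * t)).2.2| ≤ R} with hS
  have hS_iff : ∀ t, 0 ≤ t → (t ∈ S ↔ ∀ r ∈ Icc 0 t, 0 ≤ (γ r).1 ∧ |(γ r).1| ≤ R ∧
      |(γ r).2.1| ≤ R ∧ |(γ r).2.2| ≤ R) := by
    intro t ht
    refine ⟨fun h r hr => ?_, fun h θ hθ => h _ ⟨by nlinarith [hθ.1], by nlinarith [hθ.2]⟩⟩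
    rcases ht.eq_or_lt with rfl | ht
    · obtain rfl : r = 0 := le_antisymm hr.2 hr.1
      simpa using h 0 ⟨le_rfl, zero_le_one⟩
    · have := h (r / t) ⟨div_nonneg hr.1 ht.le, (div_le_one ht).2 hr.2⟩
      rwa [div_mul_cancel₀ _ ht.ne'] at this
  have hclosed : IsClosed S := by
    simp only [hS, ofPred_forall, ofPred_and]
    refine isClosed_biInter fun θ _ => ?_
    refine IsClosed.inter ?_ (IsClosed.inter ?_ (IsClosed.inter ?_ ?_)) <;>
      exact isClosed_le (by fun_prop) (by fun_prop)
  have harc : ∀ t ∈ Icc (0 : ℝ) 1200, t ∈ S →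
      IsArc c t (fun t => (γ t).1) (fun t => (γ t).2.1) (fun t => (γ t).2.2) := fun t ht h =>
    isArc_of_truncated h0 hγ ht.2 ((hS_iff t ht.1).1 h)
  have hsub : Icc (0 : ℝ) 1200 ⊆ S := by
    refine (hclosed.inter isClosed_Icc).Icc_subset_of_forall_mem_nhdsWithin ?_ ?_
    · rw [hS_iff 0 le_rfl]
      intro r hr
      obtain rfl : r = 0 := le_antisymm hr.2 hr.1
      have := hc.1
      have := hc.2
      simp only [h0, abs_zero, abs_one, abs_of_nonneg hc.1]
      exact ⟨le_rfl, by linarith, by linarith, by linarith⟩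
    · rintro t ⟨htS, ht⟩
      have ht' := Ico_subset_Icc_self ht
      have ht0 := ht.1
      have h := harc t ht' htS
      obtain ⟨h1, h2, h3⟩ := hbdd t ht' h
      have e1 : ∀ᶠ r in 𝓝 t, |(γ r).1| < R :=
        (by fun_prop : Continuous fun r => |(γ r).1|).continuousAt.eventually_lt_const h1
      have e2 : ∀ᶠ r in 𝓝 t, |(γ r).2.1| < R :=
        (by fun_prop : Continuous fun r => |(γ r).2.1|).continuousAt.eventually_lt_const h2
      have e3 : ∀ᶠ r in 𝓝 t, |(γ r).2.2| < R :=
        (by fun_prop : Continuous fun r => |(γ r).2.2|).continuousAt.eventually_lt_const h3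
      have e4 : ∀ᶠ r in 𝓝[>] t, 0 ≤ (γ r).1 := by
        rcases ht.1.eq_or_lt with rfl | htpos
        · have hy : ∀ᶠ r in 𝓝 (0 : ℝ), 0 < (clamp R (γ r)).2.1 := by
            refine (by have := (lipschitzWith_clamp R).continuous
                       fun_prop :
              Continuous fun r => (clamp R (γ r)).2.1).continuousAt.eventually_const_lt ?_
            have : (1 : ℝ) ≤ R := by linarith
            simp [clamp, h0, this]
          obtain ⟨ε, hε, hball⟩ := Metric.eventually_nhds_iff.1 hy
          filter_upwards [Ioo_mem_nhdsGT (lt_min hε (by norm_num : (0 : ℝ) < 1200))] with r hr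
          have hr1 := hr.2.trans_le (min_le_left ..)
          have hr2 := hr.2.trans_le (min_le_right ..)
          have := le_of_hasDerivWithinAt_nonneg (fun u hu => (hγ u hu).fst) le_rfl hr.1.le hr2.le
            (fun u hu => (hball (y := u) (by
              rw [Real.dist_eq, sub_zero, abs_of_nonneg hu.1]
              exact hu.2.trans_lt hr1)).le)
          simpa [h0] using this
        · have hpos : 0 < (γ t).1 := lt_of_le_of_ne (h.nonneg t (right_mem_Icc.2 ht.1))
            (Ne.symm (hno t ⟨htpos, ht.2.le⟩ h))
          have : ∀ᶠ r in 𝓝 t, 0 < (γ r).1 :=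
            (by fun_prop : Continuous fun r => (γ r).1).continuousAt.eventually_const_lt hpos
          exact (this.filter_mono nhdsWithin_le_nhds).mono fun _ h => h.le
      have e := e4.and ((e1.and (e2.and e3)).filter_mono nhdsWithin_le_nhds)
      obtain ⟨b, hb, hbsub⟩ := mem_nhdsGT_iff_exists_Ioo_subset.1 e
      filter_upwards [Ioo_mem_nhdsGT hb] with u hu
      rw [hS_iff u (ht.1.trans hu.1.le)]
      intro r hr
      rcases le_or_gt r t with hrt | hrt
      · exact (hS_iff t ht.1).1 htS r ⟨hr.1, hrt⟩
      · obtain ⟨a1, a2, a3, a4⟩ := hbsub ⟨hrt, hr.2.trans_lt hu.2⟩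
        exact ⟨a1, a2.le, a3.le, a4.le⟩
  have hlast : (1200 : ℝ) ∈ Icc (0 : ℝ) 1200 := by norm_num
  exact lt_irrefl _ ((harc _ hlast (hsub hlast)).lt_time_bound hc hlast.1)

namespace IsArc

variable {c s : ℝ} {x y g : ℝ → ℝ}

lemma x_pos (h : IsArc c s x y g) {t : ℝ} (ht : t ∈ Ioo 0 s) : 0 < x t := by
  have ht' := Ioo_subset_Icc_self ht
  refine lt_of_le_of_ne (h.nonneg t ht') fun h0 => ?_
  have hnhds : Icc 0 s ∈ 𝓝 t := Icc_mem_nhds ht.1 ht.2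
  have hmin : IsMinOn x (Icc 0 s) t := fun r hr => h0 ▸ h.nonneg r hr
  have hy := (hmin.isLocalMin hnhds).hasDerivAt_eq_zero ((h.hasDeriv_x t ht').hasDerivAt hnhds)
  have := h.energy ht'
  norm_num [hy, ← h0] at this

lemma y_end (h : IsArc c s x y g) (hs : 0 < s) (hxs : x s = 0) : y s = -1 := by
  have hss : s ∈ Icc 0 s := right_mem_Icc.2 hs.le
  have he := h.energy hss
  rw [hxs, mul_zero, zero_mul, add_zero] at he
  replace he : y s = 1 ∨ y s = -1 := by simpa using he
  refine he.resolve_left fun h1 => ?_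
  have hev : ∀ᶠ t in 𝓝[Icc 0 s] s, 1 / 2 < y t :=
    (h.continuousOn_y s hss).eventually_const_lt (by norm_num [h1])
  obtain ⟨ε, hε, hball⟩ := Metric.mem_nhdsWithin_iff.1 hev
  have hu0 : 0 ≤ max 0 (s - ε / 2) := le_max_left ..
  have hus : max 0 (s - ε / 2) < s := max_lt hs (by linarith)
  have := le_of_hasDerivWithinAt_nonneg (f := fun t => x t - t / 2)
    (fun t ht => (h.hasDeriv_x t ht).sub ((hasDerivWithinAt_id t _).div_const 2)) hu0 hus.le le_rfl
    (fun t ht => by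
      have hmem : t ∈ Metric.ball s ε ∩ Icc 0 s := by
        refine ⟨?_, hu0.trans ht.1, ht.2⟩
        rw [Metric.mem_ball, Real.dist_eq, abs_lt]
        have := (le_max_right 0 (s - ε / 2)).trans ht.1
        exact ⟨by linarith, by linarith [ht.2]⟩
      exact sub_nonneg.2 (hball hmem).le)
  have := h.nonneg _ ⟨hu0, hus.le⟩
  linarith

end IsArc

lemma exists_balanced_arc :
    ∃ (c s : ℝ) (x y g : ℝ → ℝ), 0 < s ∧ IsArc c s x y g ∧ x s = 0 ∧ y s = -1 ∧ g s = -c := by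
  obtain ⟨γ, hcont, hγ⟩ := exists_truncated_flow (R := 2000000) (by norm_num)
  have hcont' : Continuous fun p : ℝ × ℝ => γ p.1 p.2 := hcont
  have hex : ∀ c ∈ Icc (0 : ℝ) 9, ∃ s ∈ Ioc (0 : ℝ) 1200,
      IsArc c s (fun t => (γ c t).1) (fun t => (γ c t).2.1) (fun t => (γ c t).2.2) ∧
        (γ c s).1 = 0 := fun c hc =>
    exists_isArc_of_truncated le_rfl hc (by fun_prop) (hγ c hc).1 (hγ c hc).2
  choose! τ hτ harc hx using hex
  have hy : ∀ c ∈ Icc (0 : ℝ) 9, (γ c (τ c)).2.1 = -1 := fun c hc =>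
    (harc c hc).y_end (hτ c hc).1 (hx c hc)
  set K : Set (ℝ × ℝ) := {p | p ∈ Icc (0 : ℝ) 9 ×ˢ Icc (0 : ℝ) 1200 ∧
    (∀ θ ∈ Icc (0 : ℝ) 1, 0 ≤ (γ p.1 (θ * p.2)).1) ∧ (γ p.1 p.2).1 = 0 ∧
    (γ p.1 p.2).2.1 ≤ 0} with hK
  have hKc : IsCompact K := by
    have c1 : IsClosed {p : ℝ × ℝ | ∀ θ ∈ Icc (0 : ℝ) 1, 0 ≤ (γ p.1 (θ * p.2)).1} := by
      simp only [ofPred_forall]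
      refine isClosed_biInter fun θ _ => isClosed_le continuous_const ?_
      exact (hcont'.comp (f := fun p : ℝ × ℝ => (p.1, θ * p.2)) (by fun_prop)).fst
    have c2 : IsClosed {p : ℝ × ℝ | (γ p.1 p.2).1 = 0} :=
      isClosed_eq (by fun_prop) (by fun_prop)
    have c3 : IsClosed {p : ℝ × ℝ | (γ p.1 p.2).2.1 ≤ 0} :=
      isClosed_le (by fun_prop) (by fun_prop)
    exact (isCompact_Icc.prod isCompact_Icc).inter_right (c1.inter (c2.inter c3))
  have hKτ : ∀ c ∈ Icc (0 : ℝ) 9, (c, τ c) ∈ K := fun c hc => by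
    have h0 := (hτ c hc).1.le
    refine ⟨⟨hc, Ioc_subset_Icc_self (hτ c hc)⟩, fun θ hθ => ?_, hx c hc, by simp [hy c hc]⟩
    exact (harc c hc).nonneg _ ⟨mul_nonneg hθ.1 h0, mul_le_of_le_one_left h0 hθ.2⟩
  have huniq : ∀ p ∈ K, p.2 = τ p.1 := by
    rintro ⟨c, t⟩ ⟨⟨hc, ht⟩, hnn, hxt, hyt⟩
    simp only at *
    have ht0 : 0 < t := lt_of_le_of_ne ht.1 (by
      rintro rfl
      norm_num [(hγ c hc).1] at hyt)
    rcases lt_trichotomy t (τ c) with hlt | heq | hgt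
    · exact absurd hxt ((harc c hc).x_pos ⟨ht0, hlt⟩).ne'
    · exact heq
    · have hmin : IsMinOn (fun r => (γ c r).1) (Icc 0 t) (τ c) := fun r hr => by
        have := hnn (r / t) ⟨div_nonneg hr.1 ht0.le, (div_le_one ht0).2 hr.2⟩
        rw [div_mul_cancel₀ _ ht0.ne'] at this
        simpa [hx c hc] using this
      have hpos := (hτ c hc).1
      have hd : HasDerivWithinAt (fun r => (γ c r).1) _ _ _ :=
        ((hγ c hc).2 (τ c) (Ioc_subset_Icc_self (hτ c hc))).fst
      have := (hmin.isLocalMin (Icc_mem_nhds hpos hgt)).hasDerivAt_eq_zero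
        (hd.hasDerivAt (Icc_mem_nhds hpos (hgt.trans_le ht.2)))
      norm_num [field, clamp, hy c hc] at this
  have hcl : ∀ C : Set (ℝ × ℝ), IsClosed C → IsClosed (Prod.fst '' (K ∩ C)) := fun C hC =>
    ((hKc.inter_right hC).image continuous_fst).isClosed
  obtain ⟨c, hc, ⟨p, ⟨hpK, hp⟩, hpc⟩, ⟨q, ⟨hqK, hq⟩, hqc⟩⟩ :=
    isPreconnected_closed_iff.1 (isPreconnected_Icc (a := (0 : ℝ)) (b := 9)) _ _
      (hcl {p | (γ p.1 p.2).2.2 + p.1 ≤ 0} (isClosed_le (by fun_prop) (by fun_prop)))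
      (hcl {p | 0 ≤ (γ p.1 p.2).2.2 + p.1} (isClosed_le (by fun_prop) (by fun_prop)))
      (fun c hc => (le_total ((γ c (τ c)).2.2 + c) 0).imp
        (fun h => ⟨_, ⟨hKτ c hc, h⟩, rfl⟩) (fun h => ⟨_, ⟨hKτ c hc, h⟩, rfl⟩))
      (by
        have hc : (0 : ℝ) ∈ Icc (0 : ℝ) 9 := by norm_num
        have := (harc 0 hc).g_le (right_mem_Icc.2 (hτ 0 hc).1.le)
        exact ⟨0, hc, _, ⟨hKτ 0 hc, by simpa using this⟩, rfl⟩)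
      (by
        have hc : (9 : ℝ) ∈ Icc (0 : ℝ) 9 := by norm_num
        have := (harc 9 hc).neg_nine_le_g (hτ 9 hc).1 (hx 9 hc) fun t ht => (harc 9 hc).x_pos ht
        exact ⟨9, hc, _, ⟨hKτ 9 hc, by simp only [mem_ofPred_eq]; linarith⟩, rfl⟩)
  have hp2 := huniq p hpK
  have hq2 := huniq q hqK
  simp only [mem_ofPred_eq] at hp hq
  rw [hp2, hpc] at hp
  rw [hq2, hqc] at hq
  exact ⟨c, τ c, _, _, _, (hτ c hc).1, harc c hc, hx c hc, hy c hc, by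
    linarith⟩

/-- A solution of an odd autonomous equation on `[0, s]` whose end values are opposite extends to an
`s`-antiperiodic solution on `ℝ`. -/
lemma exists_antiperiodic_extension {E : Type*} [NormedAddCommGroup E] [NormedSpace ℝ E]
    {F : E → E} (hF : ∀ v, F (-v) = -F v) {s : ℝ} (hs : 0 < s) {γ : ℝ → E}
    (hγ : ∀ t ∈ Icc 0 s, HasDerivWithinAt γ (F (γ t)) (Icc 0 s) t) (hend : γ s = -γ 0) :
    ∃ Γ : ℝ → E, Γ 0 = γ 0 ∧ (∀ t, HasDerivAt Γ (F (Γ t)) t) ∧ Function.Antiperiodic Γ s ∧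
      ∀ t, ∃ r ∈ Icc 0 s, Γ t = γ r ∨ Γ t = -γ r := by
  set Γ : ℝ → E := fun t => ((-1 : ℝ) ^ ⌊t / s⌋) • γ (t - ⌊t / s⌋ * s) with hΓ
  have hsign (n : ℤ) : (-1 : ℝ) ^ n = 1 ∨ (-1 : ℝ) ^ n = -1 := by
    rcases n.even_or_odd with h | h
    · exact .inl h.neg_one_zpow
    · exact .inr h.neg_one_zpow
  have hmem (n : ℤ) {t : ℝ} (ht : t ∈ Icc (n * s) ((n + 1) * s)) : t - n * s ∈ Icc 0 s :=
    ⟨by linarith [ht.1], by linarith [ht.2]⟩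
  have hfloor (t : ℝ) : ⌊t / s⌋ * s ≤ t ∧ t < (⌊t / s⌋ + 1) * s :=
    ⟨(le_div_iff₀ hs).1 (Int.floor_le _), (div_lt_iff₀ hs).1 (Int.lt_floor_add_one _)⟩
  have hΓ_eq (n : ℤ) {t : ℝ} (ht : t ∈ Icc (n * s) ((n + 1) * s)) :
      Γ t = ((-1 : ℝ) ^ n) • γ (t - n * s) := by
    rcases ht.2.eq_or_lt with rfl | hlt
    · have hfl : ⌊((n : ℝ) + 1) * s / s⌋ = n + 1 := by
        rw [mul_div_cancel_right₀ _ hs.ne', Int.floor_add_one, Int.floor_intCast]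
      have h1 : ((n : ℝ) + 1) * s - n * s = s := by ring
      simp only [hΓ, hfl]
      push_cast
      rw [sub_self, h1, hend, zpow_add_one₀ (by norm_num)]
      simp
    · have hfl : ⌊t / s⌋ = n :=
        Int.floor_eq_iff.2 ⟨(le_div_iff₀ hs).2 ht.1, (div_lt_iff₀ hs).2 hlt⟩
      simp only [hΓ, hfl]
  have hderiv (n : ℤ) {t : ℝ} (ht : t ∈ Icc (n * s) ((n + 1) * s)) :
      HasDerivWithinAt Γ (F (Γ t)) (Icc (n * s) ((n + 1) * s)) t := by
    have h1 : HasDerivWithinAt (fun t => γ (t - n * s)) (F (γ (t - n * s)))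
        (Icc (n * s) ((n + 1) * s)) t := by
      have := (hγ _ (hmem n ht)).scomp t ((hasDerivWithinAt_id t _).sub_const (n * s))
        (fun u hu => hmem n hu)
      simpa [Function.comp_def] using this
    have h2 : F (Γ t) = ((-1 : ℝ) ^ n) • F (γ (t - n * s)) := by
      rw [hΓ_eq n ht]
      rcases hsign n with h | h <;> simp [h, hF]
    rw [h2]
    exact (h1.const_smul ((-1 : ℝ) ^ n)).congr (fun u hu => hΓ_eq n hu) (hΓ_eq n ht)
  refine ⟨Γ, by simp [hΓ], fun t => ?_, fun t => ?_, fun t => ?_⟩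
  · obtain ⟨h1, h2⟩ := hfloor t
    rcases h1.eq_or_lt with heq | hlt
    · set n := ⌊t / s⌋
      have hl : t ∈ Icc (((n - 1 : ℤ) : ℝ) * s) (((n - 1 : ℤ) + 1) * s) := by
        push_cast
        constructor <;> linarith
      refine ((hderiv (n - 1) hl).union (hderiv n ⟨h1, h2.le⟩)).hasDerivAt ?_
      push_cast
      rw [sub_add_cancel, Icc_union_Icc_eq_Icc (by linarith) (by linarith)]
      exact Icc_mem_nhds (by linarith) h2
    · exact (hderiv _ ⟨h1, h2.le⟩).hasDerivAt (Icc_mem_nhds hlt h2)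
  · have hfl : ⌊(t + s) / s⌋ = ⌊t / s⌋ + 1 := by
      rw [add_div, div_self hs.ne', Int.floor_add_one]
    simp only [hΓ, hfl]
    rw [zpow_add_one₀ (by norm_num)]
    push_cast
    rw [show t + s - (⌊t / s⌋ + 1) * s = t - ⌊t / s⌋ * s by ring]
    simp
  · obtain ⟨h1, h2⟩ := hfloor t
    refine ⟨_, hmem _ ⟨h1, h2.le⟩, ?_⟩
    simp only [hΓ]
    rcases hsign ⌊t / s⌋ with h | h <;> simp [h]

lemma hasDerivAt_abs_cube (x : ℝ) : HasDerivAt (fun x : ℝ => |x| ^ 3) (3 * x * |x|) x := by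
  have h := hasDerivAt_abs_rpow x (p := 3) (by norm_num)
  have h1 (r : ℝ) : r ^ (3 : ℝ) = r ^ 3 := by exact_mod_cast Real.rpow_natCast r 3
  have h2 : |x| ^ ((3 : ℝ) - 2) = |x| := by norm_num
  simp only [h1, h2] at h
  exact h.congr_deriv (by ring)

/-- A periodic orbit on the level `H = -1 / 2`. -/
lemma exists_periodic_solution :
    ∃ (T : ℝ) (X Y Z : ℝ → ℝ), 0 < T ∧ Function.Periodic X T ∧ Y 0 = 1 ∧
      (∀ t, HasDerivAt X (Y t) t) ∧ (∀ t, HasDerivAt Y (Z t) t) ∧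
      (∀ t, HasDerivAt Z (-(|X t| ^ 3 * Z t + 4 * X t * |X t| * Y t ^ 2)) t) ∧
      ∀ t, X t * Z t - Y t ^ 2 / 2 + |X t| ^ 3 * X t * Y t = -1 / 2 := by
  obtain ⟨c, s, x, y, g, hs, h, hx, hy, hg⟩ := exists_balanced_arc
  obtain ⟨Γ, h0, hΓ, hanti, hrange⟩ := exists_antiperiodic_extension
    (F := fun v : ℝ × ℝ × ℝ => (v.2.1, v.2.2 - |v.1| ^ 3 * v.2.1, -(v.1 * |v.1| * v.2.1 ^ 2)))
    (fun v => by ext <;> simp; ring) hs (γ := fun t => (x t, y t, g t))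
    (fun t ht => by
      have := (h.hasDeriv_x t ht).prodMk ((h.hasDeriv_y t ht).prodMk (h.hasDeriv_g t ht))
      simpa only [abs_of_nonneg (h.nonneg t ht), ← sq] using this)
    (by simp [hx, hy, hg, h.x_zero, h.y_zero, h.g_zero])
  have hX (t : ℝ) : HasDerivAt (fun t => (Γ t).1) (Γ t).2.1 t := (hΓ t).fst
  have hY (t : ℝ) : HasDerivAt (fun t => (Γ t).2.1) ((Γ t).2.2 - |(Γ t).1| ^ 3 * (Γ t).2.1) t :=
    (hΓ t).snd.fst
  have hG (t : ℝ) : HasDerivAt (fun t => (Γ t).2.2) (-((Γ t).1 * |(Γ t).1| * (Γ t).2.1 ^ 2)) t :=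
    (hΓ t).snd.snd
  refine ⟨2 * s, fun t => (Γ t).1, fun t => (Γ t).2.1,
    fun t => (Γ t).2.2 - |(Γ t).1| ^ 3 * (Γ t).2.1, by linarith,
    fun t => ?_, by simp [h0, h.y_zero], hX, hY, fun t => ?_, fun t => ?_⟩
  · have : Γ (t + 2 * s) = Γ t := by
      rw [two_mul, ← add_assoc, hanti, hanti, neg_neg]
    simp only [this]
  · have hcube : HasDerivAt (fun t => |(Γ t).1| ^ 3) _ t := (hasDerivAt_abs_cube _).comp t (hX t)
    exact ((hG t).sub (hcube.mul (hY t))).congr_deriv (by ring)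
  · have henergy : (Γ t).2.1 ^ 2 = 1 + 2 * (Γ t).1 * (Γ t).2.2 := by
      obtain ⟨r, hr, hr'⟩ := hrange t
      have := h.energy hr
      rcases hr' with hr' | hr' <;> simp only [hr', Prod.neg_mk] <;> linarith
    linear_combination (-1 / 2 : ℝ) * henergy

end Chazy

/-- For `q = 3` and `k = 4`, the (continuous) generalized Chazy equation
`x''' + |x|^3 x'' + 4 x |x| x'^2 = 0` has, on each negative energy level
`H = x x'' - x'^2/2 + |x|^3 x x' = -ω^2`, a nonconstant periodic solution. -/
theorem chazy_q3_periodic_orbits :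
    ∀ ω : ℝ, 0 < ω →
      ∃ (T : ℝ) (x : ℝ → ℝ),
        0 < T ∧
        Function.Periodic x T ∧
        (¬ ∃ c : ℝ, ∀ t : ℝ, x t = c) ∧
        ContDiff ℝ 3 x ∧
        (∀ t : ℝ,
          deriv (deriv (deriv x)) t + |x t| ^ 3 * deriv (deriv x) t
            + 4 * x t * |x t| * (deriv x t) ^ 2 = 0) ∧
        (∀ t : ℝ, x t * deriv (deriv x) t - (deriv x t) ^ 2 / 2
            + |x t| ^ 3 * x t * deriv x t = -ω ^ 2) := by
  intro ω hω
  obtain ⟨T, X, Y, Z, hT, hper, hY0, hX, hY, hZ, hH⟩ := Chazy.exists_periodic_solution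
  obtain ⟨l, hl, hl8⟩ : ∃ l : ℝ, 0 < l ∧ l ^ 8 = 2 * ω ^ 2 := by
    have h : 0 < 2 * ω ^ 2 := by positivity
    refine ⟨(2 * ω ^ 2) ^ ((8 : ℕ) : ℝ)⁻¹, by positivity, ?_⟩
    exact Real.rpow_inv_natCast_pow h.le (by norm_num)
  have hscale {f : ℝ → ℝ} {f' : ℝ} (k : ℕ) (t : ℝ) (hf : HasDerivAt f f' (l ^ 3 * t)) :
      HasDerivAt (fun t => l ^ k * f (l ^ 3 * t)) (l ^ (k + 3) * f') t := by
    have := (hf.comp t ((hasDerivAt_id t).const_mul (l ^ 3))).const_mul (l ^ k)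
    exact this.congr_deriv (by ring)
  have d1 : deriv (fun t => l ^ 1 * X (l ^ 3 * t)) = fun t => l ^ 4 * Y (l ^ 3 * t) :=
    funext fun t => (hscale 1 t (hX _)).deriv
  have d2 : deriv (fun t => l ^ 4 * Y (l ^ 3 * t)) = fun t => l ^ 7 * Z (l ^ 3 * t) :=
    funext fun t => (hscale 4 t (hY _)).deriv
  have d3 : deriv (fun t => l ^ 7 * Z (l ^ 3 * t)) = fun t => l ^ 10 *
      -(|X (l ^ 3 * t)| ^ 3 * Z (l ^ 3 * t) + 4 * X (l ^ 3 * t) * |X (l ^ 3 * t)| *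
        Y (l ^ 3 * t) ^ 2) :=
    funext fun t => (hscale 7 t (hZ _)).deriv
  have cX : Continuous X := continuous_iff_continuousAt.2 fun t => (hX t).continuousAt
  have cY : Continuous Y := continuous_iff_continuousAt.2 fun t => (hY t).continuousAt
  have cZ : Continuous Z := continuous_iff_continuousAt.2 fun t => (hZ t).continuousAt
  refine ⟨T / l ^ 3, fun t => l ^ 1 * X (l ^ 3 * t), by positivity, fun t => ?_, ?_, ?_,
    fun t => ?_, fun t => ?_⟩
  · have : l ^ 3 * (t + T / l ^ 3) = l ^ 3 * t + T := by field_simp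
    simp only [this, hper _]
  · rintro ⟨c, hc⟩
    have h := congrFun d1 0
    rw [funext hc] at h
    simp only [deriv_const, mul_zero, hY0, mul_one] at h
    exact (pow_pos hl 4).ne h
  · rw [show (3 : WithTop ℕ∞) = 2 + 1 by norm_num, contDiff_succ_iff_deriv, d1,
      show (2 : WithTop ℕ∞) = 1 + 1 by norm_num, contDiff_succ_iff_deriv, d2,
      contDiff_one_iff_deriv, d3]
    exact ⟨fun t => (hscale 1 t (hX _)).differentiableAt, by simp,
      fun t => (hscale 4 t (hY _)).differentiableAt, by simp,
      fun t => (hscale 7 t (hZ _)).differentiableAt, by fun_prop⟩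
  · rw [d1, d2, d3]
    simp only [abs_mul, abs_pow, abs_of_pos hl]
    ring
  · rw [d1, d2]
    simp only [abs_mul, abs_pow, abs_of_pos hl]
    linear_combination l ^ 8 * hH (l ^ 3 * t) - hl8 / 2
end
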